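/- arXiv:1801.10431 — 3 statements merged into one kernel-verified Lean document; each statement's English description precedes it below -/
import Mathlib

section
/- There exist a real constant c > 0, a constant C > 0 and a positive integer n₀ such that for every finite set A of positive real numbers with |A| ≥ n₀ one has |AA+A| ≥ C·|A|^(3/2 + c). -/
section

open Finset
open scoped Pointwise

/-- A finite set of at most `r * s` reals splits into `r` consecutive blocks of at most `s`
elements; the block number is a monotone function. -/
lemma exists_monotone_blocks (X : Finset ℝ) {r s : ℕ} (hs : 0 < s) (hX : #X ≤ r * s) :
    ∃ c : ℝ → ℕ, Monotone c ∧ (∀ x ∈ X, c x < r) ∧ ∀ i, #{x ∈ X | c x = i} ≤ s := by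
  have hrank : ∀ x ∈ X, ∀ y ∈ X, x < y → #{z ∈ X | z < x} < #{z ∈ X | z < y} := by
    intro x hx y hy hxy
    apply card_lt_card
    rw [ssubset_iff_of_subset]
    · exact ⟨x, by simp [hx, hxy], by simp⟩
    · intro z hz
      simp only [mem_filter] at hz ⊢
      exact ⟨hz.1, hz.2.trans hxy⟩
  refine ⟨fun x => #{y ∈ X | y < x} / s, ?_, ?_, ?_⟩
  · intro x y hxy
    apply Nat.div_le_div_right
    apply card_le_card
    intro z hz
    simp only [mem_filter] at hz ⊢
    exact ⟨hz.1, hz.2.trans_le hxy⟩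
  · intro x hx
    rw [Nat.div_lt_iff_lt_mul hs]
    refine lt_of_lt_of_le (card_lt_card ?_) hX
    rw [ssubset_iff_of_subset (filter_subset _ _)]
    exact ⟨x, hx, by simp⟩
  · intro i
    have : #{x ∈ X | #{y ∈ X | y < x} / s = i} ≤ #(Ico (i * s) (i * s + s)) := by
      apply card_le_card_of_injOn (fun x => #{y ∈ X | y < x})
      · intro x hx
        simp only [coe_filter, Set.mem_ofPred_eq] at hx
        simp only [coe_Ico, Set.mem_Ico]
        have h1 := Nat.div_add_mod #{y ∈ X | y < x} s
        have h2 := Nat.mod_lt #{y ∈ X | y < x} hs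
        rw [hx.2, mul_comm] at h1
        omega
      · intro x hx y hy hxy
        simp only [coe_filter, Set.mem_ofPred_eq] at hx hy
        simp only at hxy
        rcases lt_trichotomy x y with h | h | h
        · have := hrank x hx.1 y hy.1 h
          omega
        · exact h
        · have := hrank y hy.1 x hx.1 h
          omega
    simpa using this

lemma card_pairs_same_block_le (X : Finset ℝ) {r s : ℕ} (c : ℝ → ℕ) (hc : ∀ x ∈ X, c x < r)
    (hs : ∀ i, #{x ∈ X | c x = i} ≤ s) :
    #{p ∈ X ×ˢ X | c p.1 = c p.2} ≤ r * s ^ 2 := by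
  have hsub : {p ∈ X ×ˢ X | c p.1 = c p.2} ⊆
      (range r).biUnion (fun i => {x ∈ X | c x = i} ×ˢ {x ∈ X | c x = i}) := by
    rintro ⟨x, y⟩ h
    simp only [mem_filter, mem_product, mem_biUnion, mem_range] at h ⊢
    exact ⟨c x, hc x h.1.1, ⟨h.1.1, rfl⟩, h.1.2, h.2.symm⟩
  calc _ ≤ _ := card_le_card hsub
    _ ≤ #(range r) * s ^ 2 := by
      apply card_biUnion_le_card_mul
      intro i _
      rw [card_product, sq]
      exact Nat.mul_le_mul (hs i) (hs i)
    _ = _ := by rw [card_range]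

/-- Cell decomposition bound for the number of incidences between a Cartesian product `X × Y`
and a set `𝓛` of non-vertical lines, given by slope and intercept. -/
lemma card_incidences_le (X Y : Finset ℝ) (𝓛 : Finset (ℝ × ℝ)) {r s t : ℕ} (hs : 0 < s)
    (ht : 0 < t) (hX : #X ≤ r * s) (hY : #Y ≤ r * t) :
    #{z ∈ X ×ˢ 𝓛 | z.2.1 * z.1 + z.2.2 ∈ Y} ≤ 2 * r * #𝓛 + r * s ^ 2 * (r * t ^ 2) := by
  classical
  obtain ⟨c, hcm, hcr, hcs⟩ := exists_monotone_blocks X hs hX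
  obtain ⟨d, hdm, hdr, hds⟩ := exists_monotone_blocks Y ht hY
  set I := {z ∈ X ×ˢ 𝓛 | z.2.1 * z.1 + z.2.2 ∈ Y} with hI
  have memI : ∀ z, z ∈ I ↔ (z.1 ∈ X ∧ z.2 ∈ 𝓛) ∧ z.2.1 * z.1 + z.2.2 ∈ Y := by
    intro z
    simp [hI]
  let f : ℝ × ℝ × ℝ → (ℝ × ℝ) × ℕ × ℕ := fun z => (z.2, c z.1, d (z.2.1 * z.1 + z.2.2))
  have himage : #(I.image f) ≤ 2 * r * #𝓛 := by
    have : #(I.image f) ≤ #(range (2 * r) ×ˢ 𝓛) := by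
      apply card_le_card_of_injOn
        (fun w => (if 0 ≤ w.1.1 then w.2.1 + w.2.2 else w.2.1 + (r - w.2.2), w.1))
      · intro w hw
        simp only [coe_image, Set.mem_image, mem_coe] at hw
        obtain ⟨z, hz, rfl⟩ := hw
        rw [memI] at hz
        have h1 := hcr _ hz.1.1
        have h2 := hdr _ hz.2
        simp only [coe_product, Set.mem_prod, coe_range, Set.mem_Iio, mem_coe, f]
        refine ⟨?_, hz.1.2⟩
        split_ifs <;> omega
      · intro w hw w' hw' h
        simp only [coe_image, Set.mem_image, mem_coe] at hw hw'
        obtain ⟨⟨x, u, v⟩, hz, rfl⟩ := hw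
        obtain ⟨⟨x', u', v'⟩, hz', rfl⟩ := hw'
        rw [memI] at hz hz'
        simp only [f, Prod.mk.injEq] at h hz hz' ⊢
        obtain ⟨h, rfl, rfl⟩ := h
        have h1 := hdr _ hz.2
        have h2 := hdr _ hz'.2
        refine ⟨⟨rfl, rfl⟩, ?_⟩
        rcases le_or_gt 0 u with hu | hu
        · rw [if_pos hu, if_pos hu] at h
          rcases le_total x x' with hx | hx
          · have h3 := hcm hx
            have h4 := hdm (add_le_add_left (mul_le_mul_of_nonneg_left hx hu) v)
            omega
          · have h3 := hcm hx
            have h4 := hdm (add_le_add_left (mul_le_mul_of_nonneg_left hx hu) v)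
            omega
        · rw [if_neg hu.not_ge, if_neg hu.not_ge] at h
          rcases le_total x x' with hx | hx
          · have h3 := hcm hx
            have h4 := hdm (add_le_add_left (mul_le_mul_of_nonpos_left hx hu.le) v)
            omega
          · have h3 := hcm hx
            have h4 := hdm (add_le_add_left (mul_le_mul_of_nonpos_left hx hu.le) v)
            omega
    rw [card_product, card_range] at this
    exact this
  have hsec : ∀ w ∈ I.image f, ∃ z ∈ I, f z = w := by
    intro w hw
    simpa using hw
  choose! g hgI hgf using hsec
  have h1 : #{z ∈ I | g (f z) = z} ≤ #(I.image f) := by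
    apply card_le_card_of_injOn f
    · intro z hz
      simp only [coe_filter, Set.mem_ofPred_eq] at hz
      exact mem_coe.2 (mem_image_of_mem f hz.1)
    · intro z hz z' hz' h
      simp only [coe_filter, Set.mem_ofPred_eq] at hz hz'
      rw [← hz.2, ← hz'.2, h]
  have h2 : #{z ∈ I | ¬ g (f z) = z} ≤ r * s ^ 2 * (r * t ^ 2) := by
    calc _ ≤ #({p ∈ X ×ˢ X | c p.1 = c p.2} ×ˢ {p ∈ Y ×ˢ Y | d p.1 = d p.2}) := by
          apply card_le_card_of_injOn (fun z => ((z.1, (g (f z)).1),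
            (z.2.1 * z.1 + z.2.2, (g (f z)).2.1 * (g (f z)).1 + (g (f z)).2.2)))
          · intro z hz
            simp only [coe_filter, Set.mem_ofPred_eq] at hz
            have hg := hgI _ (mem_image_of_mem f hz.1)
            have hf := hgf _ (mem_image_of_mem f hz.1)
            have hz1 := (memI _).1 hz.1
            rw [memI] at hg
            simp only [f, Prod.mk.injEq] at hf
            simp only [coe_product, coe_filter, mem_product, Set.mem_prod, Set.mem_ofPred_eq]
            exact ⟨⟨⟨hz1.1.1, hg.1.1⟩, hf.2.1.symm⟩, ⟨hz1.2, hg.2⟩, hf.2.2.symm⟩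
          · have key : ∀ z ∈ I, ¬ g (f z) = z → (g (f z)).2 = z.2 ∧ (g (f z)).1 ≠ z.1 := by
              intro z hz hne
              have hf := hgf _ (mem_image_of_mem f hz)
              have h2 : (g (f z)).2 = z.2 := congrArg Prod.fst hf
              exact ⟨h2, fun h => hne (Prod.ext h h2)⟩
            intro z hz z' hz' h
            simp only [coe_filter, Set.mem_ofPred_eq] at hz hz'
            obtain ⟨e1, n1⟩ := key z hz.1 hz.2
            obtain ⟨e2, n2⟩ := key z' hz'.1 hz'.2
            simp only [Prod.mk.injEq, e1, e2] at h
            obtain ⟨⟨a1, a2⟩, a3, a4⟩ := h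
            rw [← a2] at a4
            rw [← a1] at a3
            have hne : (g (f z)).1 - z.1 ≠ 0 := sub_ne_zero.2 n1
            have hu : z.2.1 = z'.2.1 := by
              apply mul_right_cancel₀ hne
              linear_combination a4 - a3
            have hv : z.2.2 = z'.2.2 := by
              rw [hu] at a3
              linarith
            exact Prod.ext a1 (Prod.ext hu hv)
      _ ≤ _ := by
          rw [card_product]
          exact Nat.mul_le_mul (card_pairs_same_block_le X c hcr hcs)
            (card_pairs_same_block_le Y d hdr hds)
  rw [← card_filter_add_card_filter_not (s := I) (fun z => g (f z) = z)]
  omega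

lemma card_incidences_le_real (X Y : Finset ℝ) (𝓛 : Finset (ℝ × ℝ)) {x y ρ : ℝ} (hρ : 1 ≤ ρ)
    (hρx : ρ ≤ x) (hρy : ρ ≤ y) (hX : (#X : ℝ) ≤ x) (hY : (#Y : ℝ) ≤ y) :
    (#{z ∈ X ×ˢ 𝓛 | z.2.1 * z.1 + z.2.2 ∈ Y} : ℝ) ≤
      2 * ρ * #𝓛 + 64 * x ^ 2 * y ^ 2 / ρ ^ 2 := by
  have hr1 : 1 ≤ ⌊ρ⌋₊ := by rwa [Nat.one_le_floor_iff]
  have hrρ : (⌊ρ⌋₊ : ℝ) ≤ ρ := Nat.floor_le (by linarith)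
  have hρr : ρ < ⌊ρ⌋₊ + 1 := Nat.lt_floor_add_one ρ
  set r := ⌊ρ⌋₊
  have hr1' : (1 : ℝ) ≤ r := by exact_mod_cast hr1
  have hr0 : (0 : ℝ) < r := by linarith
  have aux : ∀ w : ℝ, ρ ≤ w → 0 < ⌈w / r⌉₊ ∧ (w ≤ r * ⌈w / r⌉₊) ∧ (r * ⌈w / r⌉₊ : ℝ) ≤ 2 * w := by
    intro w hw
    have hw0 : 0 < w := by linarith
    refine ⟨Nat.ceil_pos.2 (by positivity), ?_, ?_⟩
    · have := Nat.le_ceil (w / r)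
      rwa [div_le_iff₀ hr0, mul_comm] at this
    · have := (Nat.ceil_lt_add_one (a := w / r) (by positivity)).le
      calc (r * ⌈w / r⌉₊ : ℝ) ≤ r * (w / r + 1) := by gcongr
        _ = w + r := by field_simp
        _ ≤ 2 * w := by linarith
  obtain ⟨s0, hs1, hs2⟩ := aux x hρx
  obtain ⟨t0, ht1, ht2⟩ := aux y hρy
  set s := ⌈x / r⌉₊
  set t := ⌈y / r⌉₊
  have h := card_incidences_le X Y 𝓛 s0 t0 (r := r)
    (by exact_mod_cast hX.trans hs1) (by exact_mod_cast hY.trans ht1)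
  have h' : (#{z ∈ X ×ˢ 𝓛 | z.2.1 * z.1 + z.2.2 ∈ Y} : ℝ) ≤
      2 * r * #𝓛 + r * s ^ 2 * (r * t ^ 2) := by exact_mod_cast h
  refine h'.trans ?_
  gcongr
  rw [le_div_iff₀ (by positivity)]
  calc (r * s ^ 2 * (r * t ^ 2) * ρ ^ 2 : ℝ) ≤ r * s ^ 2 * (r * t ^ 2) * (2 * r) ^ 2 := by
        gcongr
        linarith
    _ = 4 * ((r * s) ^ 2 * (r * t) ^ 2) := by ring
    _ ≤ 4 * ((2 * x) ^ 2 * (2 * y) ^ 2) := by gcongr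
    _ = _ := by ring

/-- If `A * P` is small, then a linear equation `α a + β b = c` with `a ∈ A`, `b ∈ B`, `c ∈ C`
has few solutions. -/
lemma card_linear_solutions_mul_card_le (A P B C : Finset ℝ) (hP : ∀ p ∈ P, 0 < p) {α β : ℝ}
    (hα : α ≠ 0) (hβ : β ≠ 0) {x y ρ : ℝ} (hρ : 1 ≤ ρ) (hρx : ρ ≤ x) (hρy : ρ ≤ y)
    (hPx : (#P : ℝ) ≤ x) (hC : (#C : ℝ) ≤ y) :
    (#{z ∈ A ×ˢ B | α * z.1 + β * z.2 ∈ C} : ℝ) * #P ≤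
      2 * ρ * (#(A * P) * #B) + 64 * x ^ 2 * y ^ 2 / ρ ^ 2 := by
  set 𝓛 : Finset (ℝ × ℝ) := ((A * P) ×ˢ B).image (fun w => (α * w.1, β * w.2)) with h𝓛
  set X : Finset ℝ := P.image (fun p => p⁻¹)
  have hX : (#X : ℝ) ≤ x := le_trans (by exact_mod_cast card_image_le) hPx
  have hL : (#𝓛 : ℝ) ≤ #(A * P) * #B := by
    rw [h𝓛]
    refine le_trans (Nat.cast_le.2 card_image_le) ?_
    rw [card_product, Nat.cast_mul]
  have hinc := card_incidences_le_real X C 𝓛 hρ hρx hρy hX hC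
  have hinj : #({z ∈ A ×ˢ B | α * z.1 + β * z.2 ∈ C} ×ˢ P) ≤
      #{z ∈ X ×ˢ 𝓛 | z.2.1 * z.1 + z.2.2 ∈ C} := by
    apply card_le_card_of_injOn (fun w => (w.2⁻¹, (α * (w.1.1 * w.2), β * w.1.2)))
    · rintro ⟨⟨a, b⟩, p⟩ hw
      simp only [coe_product, coe_filter, mem_product, Set.mem_prod, Set.mem_ofPred_eq,
        mem_coe] at hw ⊢
      obtain ⟨⟨⟨ha, hb⟩, hc⟩, hp⟩ := hw
      refine ⟨⟨mem_image_of_mem _ hp, mem_image.2 ⟨(a * p, b), ?_, rfl⟩⟩, ?_⟩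
      · exact mem_product.2 ⟨mul_mem_mul ha hp, hb⟩
      · have := (hP p hp).ne'
        have e : α * (a * p) * p⁻¹ + β * b = α * a + β * b := by field_simp
        rwa [e]
    · rintro ⟨⟨a, b⟩, p⟩ hw ⟨⟨a', b'⟩, p'⟩ hw' h
      simp only [coe_product, coe_filter, mem_product, Set.mem_prod, Set.mem_ofPred_eq,
        mem_coe] at hw hw'
      simp only [Prod.mk.injEq, inv_inj] at h ⊢
      obtain ⟨rfl, h1, h2⟩ := h
      exact ⟨⟨mul_right_cancel₀ (hP p hw.2).ne' (mul_left_cancel₀ hα h1),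
        mul_left_cancel₀ hβ h2⟩, rfl⟩
  have hinj' : (#{z ∈ A ×ˢ B | α * z.1 + β * z.2 ∈ C} : ℝ) * #P ≤
      #{z ∈ X ×ˢ 𝓛 | z.2.1 * z.1 + z.2.2 ∈ C} := by
    rw [card_product] at hinj
    exact_mod_cast hinj
  calc _ ≤ _ := hinj'
    _ ≤ _ := hinc
    _ ≤ _ := by gcongr

/-- If `A * P` is small, then few differences have many representations in `A - A`. -/
lemma card_popular_differences_mul_card_le (A P D : Finset ℝ) (hP : ∀ p ∈ P, 0 < p) {K κ : ℝ}
    (hK : 1 ≤ K) (hκ : 1 ≤ κ) (hAP : (#(A * P) : ℝ) ≤ K * #A) (hPA : #P ≤ #A)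
    (hPK : 4 * K * κ ≤ #P)
    (hD : ∀ d ∈ D, (#A : ℝ) / κ ≤ #{z ∈ A ×ˢ A | z.1 - z.2 = d}) :
    (#D : ℝ) * #P ≤ 2048 * K ^ 2 * κ ^ 3 * #A := by
  have hPA' : (#P : ℝ) ≤ #A := by exact_mod_cast hPA
  have hP0 : (0 : ℝ) < #P := by nlinarith
  have hA0 : (0 : ℝ) < #A := by linarith
  have hKκ : 1 ≤ K * κ := by nlinarith
  have hρ1 : 1 ≤ (#P : ℝ) / (4 * K * κ) := by
    rw [le_div_iff₀ (by positivity)]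
    linarith
  have hρ2 : (#P : ℝ) / (4 * K * κ) ≤ #P := by
    rw [div_le_iff₀ (by positivity)]
    nlinarith
  have h := card_linear_solutions_mul_card_le A P D A hP (α := 1) (β := -1) one_ne_zero
    (by norm_num) hρ1 hρ2 (hρ2.trans hPA') le_rfl le_rfl
  have hsum : (#D : ℝ) * (#A / κ) ≤ #{z ∈ A ×ˢ D | 1 * z.1 + -1 * z.2 ∈ A} := by
    have h1 : ∑ d ∈ D, #{z ∈ A ×ˢ A | z.1 - z.2 = d} ≤
        #{z ∈ A ×ˢ D | 1 * z.1 + -1 * z.2 ∈ A} := by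
      rw [← card_sigma]
      apply card_le_card_of_injOn (fun w => (w.2.1, w.1))
      · rintro ⟨d, a, b⟩ hw
        simp only [coe_sigma, coe_filter, mem_product, Set.mem_sigma_iff, Set.mem_ofPred_eq,
          mem_coe] at hw ⊢
        obtain ⟨hd, ⟨ha, hb⟩, hab⟩ := hw
        refine ⟨⟨ha, hd⟩, ?_⟩
        rw [← hab]
        convert hb using 1
        ring
      · rintro ⟨d, a, b⟩ hw ⟨d', a', b'⟩ hw' h
        simp only [coe_sigma, coe_filter, mem_product, Set.mem_sigma_iff, Set.mem_ofPred_eq,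
          mem_coe] at hw hw'
        simp only [Prod.mk.injEq] at h
        obtain ⟨rfl, rfl⟩ := h
        have : b = b' := by linarith [hw.2.2, hw'.2.2]
        rw [this]
    calc (#D : ℝ) * (#A / κ) = ∑ d ∈ D, (#A : ℝ) / κ := by simp
      _ ≤ ∑ d ∈ D, (#{z ∈ A ×ˢ A | z.1 - z.2 = d} : ℝ) := sum_le_sum hD
      _ ≤ _ := by exact_mod_cast h1
  have h2 : (#D : ℝ) * (#A / κ) * #P ≤ 2 * (#P / (4 * K * κ)) * (K * #A * #D) +
      64 * #P ^ 2 * #A ^ 2 / (#P / (4 * K * κ)) ^ 2 := by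
    calc _ ≤ _ := mul_le_mul_of_nonneg_right hsum hP0.le
      _ ≤ _ := h
      _ ≤ _ := by gcongr
  have e : 2 * (#P / (4 * K * κ)) * (K * #A * #D) +
      64 * #P ^ 2 * #A ^ 2 / (#P / (4 * K * κ)) ^ 2 =
      (#D : ℝ) * (#A / κ) * #P / 2 + 1024 * K ^ 2 * κ ^ 2 * #A ^ 2 := by
    have hK0 : K ≠ 0 := by positivity
    have hκ0 : κ ≠ 0 := by positivity
    field_simp
    ring
  rw [e] at h2
  have h3 : (#D : ℝ) * (#A / κ) * #P ≤ 2048 * K ^ 2 * κ ^ 2 * #A ^ 2 := by linarith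
  have e2 : (#D : ℝ) * (#A / κ) * #P = #D * #P * (#A / κ) := by ring
  rw [e2, ← le_div_iff₀ (by positivity)] at h3
  refine h3.trans_eq ?_
  field_simp

lemma card_difference_le (A : Finset ℝ) (d : ℝ) : #{z ∈ A ×ˢ A | z.1 - z.2 = d} ≤ #A := by
  apply card_le_card_of_injOn Prod.fst
  · intro z hz
    simp only [coe_filter, mem_product, Set.mem_ofPred_eq] at hz
    exact hz.1.1
  · intro z hz z' hz' h
    simp only [coe_filter, mem_product, Set.mem_ofPred_eq] at hz hz'
    exact Prod.ext h (by linarith [hz.2, hz'.2])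

/-- Number of triples whose associated difference is a popular difference of `A`. -/
lemma card_popular_triples_le (A P Q : Finset ℝ) (hP : ∀ p ∈ P, 0 < p) {K t p₀ : ℝ}
    (ht : t ≠ 0) (hp₀ : p₀ ∈ P) (hK : 1000 ≤ K) (hQP : #Q = #P)
    (hAP : (#(A * P) : ℝ) ≤ K * #A) (hPA : #P ≤ #A) (hAle : (#A : ℝ) ≤ 16 * K ^ 2 * #P ^ 2)
    (hPK : K ^ 40 ≤ #P) :
    (#{w ∈ (P ×ˢ Q) ×ˢ Q | (#A : ℝ) / (18 * K ^ 2) ≤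
      #{z ∈ A ×ˢ A | z.1 - z.2 = t * w.1.2 / w.1.1 - t * w.2 / p₀}} : ℝ) ≤
      #P ^ 3 / (18 * K ^ 2) := by
  set D : Finset ℝ := {d ∈ A - A | (#A : ℝ) / (18 * K ^ 2) ≤ #{z ∈ A ×ˢ A | z.1 - z.2 = d}}
    with hD
  have hK1 : 1 ≤ K := by linarith
  have hpow : ∀ m : ℕ, 1 ≤ K ^ m := fun m => one_le_pow₀ hK1
  have hP0 : (0 : ℝ) < #P := by linarith [hpow 40]
  have hPA' : (#P : ℝ) ≤ #A := by exact_mod_cast hPA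
  have hA0 : (0 : ℝ) < #A := by linarith
  have hP72 : 72 * K ^ 3 ≤ #P := by
    calc 72 * K ^ 3 ≤ K * K ^ 3 := by gcongr; linarith
      _ = K ^ 4 := by ring
      _ ≤ K ^ 40 := pow_le_pow_right₀ hK1 (by norm_num)
      _ ≤ _ := hPK
  have hDcard : (#D : ℝ) ≤ 2048 * 5832 * 16 * K ^ 10 * #P := by
    have h := card_popular_differences_mul_card_le A P D hP hK1 (κ := 18 * K ^ 2)
      (by linarith [hpow 2]) hAP hPA (by linarith) (fun d hd => (mem_filter.1 hd).2)
    have h2 : (#D : ℝ) * #P ≤ 2048 * 5832 * 16 * K ^ 10 * #P * #P := by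
      calc _ ≤ _ := h
        _ ≤ 2048 * K ^ 2 * (18 * K ^ 2) ^ 3 * (16 * K ^ 2 * #P ^ 2) := by gcongr
        _ = _ := by ring
    exact le_of_mul_le_mul_right h2 hP0
  set 𝓛 : Finset (ℝ × ℝ) := (P ×ˢ Q).image (fun w => (t / w.1, -(t * w.2 / p₀))) with h𝓛
  have hL : (#𝓛 : ℝ) ≤ #P * #P := by
    rw [h𝓛]
    refine le_trans (Nat.cast_le.2 card_image_le) ?_
    rw [card_product, Nat.cast_mul, hQP]
  have hρ1 : 1 ≤ (#P : ℝ) / (72 * K ^ 2) := by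
    rw [le_div_iff₀ (by positivity)]
    have : K ^ 2 ≤ K ^ 3 := pow_le_pow_right₀ hK1 (by norm_num)
    linarith
  have hρ2 : (#P : ℝ) / (72 * K ^ 2) ≤ #P := by
    rw [div_le_iff₀ (by positivity)]
    nlinarith [hpow 2]
  have hinc := card_incidences_le_real Q D 𝓛 (x := #P) (y := 2048 * 5832 * 16 * K ^ 10 * #P)
    hρ1 hρ2 (hρ2.trans (by nlinarith [hpow 10])) (by rw [hQP]) hDcard
  have hinj : #{w ∈ (P ×ˢ Q) ×ˢ Q | (#A : ℝ) / (18 * K ^ 2) ≤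
      #{z ∈ A ×ˢ A | z.1 - z.2 = t * w.1.2 / w.1.1 - t * w.2 / p₀}} ≤
      #{z ∈ Q ×ˢ 𝓛 | z.2.1 * z.1 + z.2.2 ∈ D} := by
    apply card_le_card_of_injOn (fun w => (w.1.2, (t / w.1.1, -(t * w.2 / p₀))))
    · rintro ⟨⟨p, q⟩, q₀⟩ hw
      simp only [coe_filter, mem_product, Set.mem_ofPred_eq] at hw ⊢
      obtain ⟨⟨⟨hp, hq⟩, hq₀⟩, hpop⟩ := hw
      refine ⟨⟨hq, mem_image.2 ⟨(p, q₀), mem_product.2 ⟨hp, hq₀⟩, rfl⟩⟩, ?_⟩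
      have e : t / p * q + -(t * q₀ / p₀) = t * q / p - t * q₀ / p₀ := by ring
      rw [e, hD, mem_filter]
      refine ⟨?_, hpop⟩
      have hpos : 0 < #{z ∈ A ×ˢ A | z.1 - z.2 = t * q / p - t * q₀ / p₀} := by
        have : (0 : ℝ) < #{z ∈ A ×ˢ A | z.1 - z.2 = t * q / p - t * q₀ / p₀} :=
          lt_of_lt_of_le (by positivity) hpop
        exact_mod_cast this
      obtain ⟨z, hz⟩ := card_pos.1 hpos
      simp only [mem_filter, mem_product] at hz
      rw [← hz.2]
      exact sub_mem_sub hz.1.1 hz.1.2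
    · rintro ⟨⟨p, q⟩, q₀⟩ hw ⟨⟨p', q'⟩, q₀'⟩ hw' h
      simp only [coe_filter, mem_product, Set.mem_ofPred_eq] at hw hw'
      simp only [Prod.mk.injEq, neg_inj] at h ⊢
      obtain ⟨h1, h2, h3⟩ := h
      have hp := hP p hw.1.1.1
      have hp' := hP p' hw'.1.1.1
      have h0 := hP p₀ hp₀
      refine ⟨⟨?_, h1⟩, ?_⟩
      · rw [div_eq_div_iff hp.ne' hp'.ne'] at h2
        exact (mul_left_cancel₀ ht h2).symm
      · rw [div_left_inj' h0.ne'] at h3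
        exact mul_left_cancel₀ ht h3
  have hinj' : (#{w ∈ (P ×ˢ Q) ×ˢ Q | (#A : ℝ) / (18 * K ^ 2) ≤
      #{z ∈ A ×ˢ A | z.1 - z.2 = t * w.1.2 / w.1.1 - t * w.2 / p₀}} : ℝ) ≤
      #{z ∈ Q ×ˢ 𝓛 | z.2.1 * z.1 + z.2.2 ∈ D} := by exact_mod_cast hinj
  have hK36 : 64 * 5184 * (2048 * 5832 * 16) ^ 2 * 36 * K ^ 26 ≤ #P := by
    calc 64 * 5184 * (2048 * 5832 * 16) ^ 2 * 36 * K ^ 26 ≤ 1000 ^ 10 * K ^ 26 := by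
          gcongr
          norm_num
      _ ≤ K ^ 10 * K ^ 26 := by gcongr
      _ = K ^ 36 := by ring
      _ ≤ K ^ 40 := pow_le_pow_right₀ hK1 (by norm_num)
      _ ≤ _ := hPK
  calc _ ≤ _ := hinj'
    _ ≤ _ := hinc
    _ ≤ 2 * (#P / (72 * K ^ 2)) * (#P * #P) + 64 * #P ^ 2 *
        (2048 * 5832 * 16 * K ^ 10 * #P) ^ 2 / (#P / (72 * K ^ 2)) ^ 2 := by gcongr
    _ = #P ^ 3 / (36 * K ^ 2) + (64 * 5184 * (2048 * 5832 * 16) ^ 2 * 36 * K ^ 26) *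
        (#P ^ 2 / (36 * K ^ 2)) := by
      field_simp
      ring
    _ ≤ #P ^ 3 / (36 * K ^ 2) + #P * (#P ^ 2 / (36 * K ^ 2)) := by gcongr
    _ = _ := by
      field_simp
      ring

/-- If `A * P` is small, then `A` contains few pairs differing by an element of `t * Q / P`,
counted with multiplicity. -/
lemma card_dilated_differences_le (A P Q : Finset ℝ) (hP : ∀ p ∈ P, 0 < p) {K t : ℝ}
    (ht : t ≠ 0) (hK : 1000 ≤ K) (hQP : #Q = #P)
    (hAP : (#(A * P) : ℝ) ≤ K * #A) (hPA : #P ≤ #A) (hAle : (#A : ℝ) ≤ 16 * K ^ 2 * #P ^ 2)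
    (hPK : K ^ 40 ≤ #P) :
    ∑ p ∈ P, (#{w ∈ A ×ˢ Q | w.1 + t * w.2 / p ∈ A} : ℝ) ≤ #A * #P ^ 2 / (3 * K) := by
  have hK0 : 0 < K := by linarith
  let g : ℝ → ℝ → ℝ := fun p a => #{q ∈ Q | a + t * q / p ∈ A}
  let h : ℝ → ℝ := fun a => ∑ p ∈ P, g p a
  have hN : ∑ p ∈ P, (#{w ∈ A ×ˢ Q | w.1 + t * w.2 / p ∈ A} : ℝ) = ∑ a ∈ A, h a := by
    simp only [h, g]
    rw [sum_comm]
    refine sum_congr rfl fun p _ => ?_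
    simp only [card_filter, sum_product, Nat.cast_sum]
  have hG : ∀ p₀ ∈ P, ∑ a ∈ A, h a * g p₀ a ≤ #A * #P ^ 3 / (9 * K ^ 2) := by
    intro p₀ hp₀
    have htrip := card_popular_triples_le A P Q hP ht hp₀ hK hQP hAP hPA hAle hPK
    set T := {w ∈ (P ×ˢ Q) ×ˢ Q | (#A : ℝ) / (18 * K ^ 2) ≤
      #{z ∈ A ×ˢ A | z.1 - z.2 = t * w.1.2 / w.1.1 - t * w.2 / p₀}} with hT
    have e1 : ∑ a ∈ A, h a * g p₀ a =
        ∑ w ∈ (P ×ˢ Q) ×ˢ Q,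
          (#{a ∈ A | a + t * w.1.2 / w.1.1 ∈ A ∧ a + t * w.2 / p₀ ∈ A} : ℝ) := by
      have e : ∀ a, h a * g p₀ a = ∑ w ∈ (P ×ˢ Q) ×ˢ Q,
          (if a + t * w.1.2 / w.1.1 ∈ A ∧ a + t * w.2 / p₀ ∈ A then (1 : ℝ) else 0) := by
        intro a
        simp only [h, g, card_filter, Nat.cast_sum, ite_and, sum_product]
        rw [sum_mul]
        refine sum_congr rfl fun p _ => ?_
        rw [sum_mul_sum]
        refine sum_congr rfl fun q _ => sum_congr rfl fun q₀ _ => ?_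
        split_ifs <;> simp
      simp only [e, card_filter, Nat.cast_sum, Nat.cast_ite, Nat.cast_one, Nat.cast_zero]
      rw [sum_comm]
    have e2 : ∀ w ∈ (P ×ˢ Q) ×ˢ Q,
        (#{a ∈ A | a + t * w.1.2 / w.1.1 ∈ A ∧ a + t * w.2 / p₀ ∈ A} : ℝ) ≤
          (if w ∈ T then (#A : ℝ) else 0) + #A / (18 * K ^ 2) := by
      intro w hw
      have h1 : #{a ∈ A | a + t * w.1.2 / w.1.1 ∈ A ∧ a + t * w.2 / p₀ ∈ A} ≤
          #{z ∈ A ×ˢ A | z.1 - z.2 = t * w.1.2 / w.1.1 - t * w.2 / p₀} := by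
        apply card_le_card_of_injOn (fun a => (a + t * w.1.2 / w.1.1, a + t * w.2 / p₀))
        · intro a ha
          simp only [coe_filter, mem_product, Set.mem_ofPred_eq] at ha ⊢
          exact ⟨⟨ha.2.1, ha.2.2⟩, by ring⟩
        · intro a _ a' _ haa
          simpa using congrArg Prod.fst haa
      have h1' : (#{a ∈ A | a + t * w.1.2 / w.1.1 ∈ A ∧ a + t * w.2 / p₀ ∈ A} : ℝ) ≤
          #{z ∈ A ×ˢ A | z.1 - z.2 = t * w.1.2 / w.1.1 - t * w.2 / p₀} := by
        exact_mod_cast h1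
      split_ifs with hwT
      · have h2 : (#{z ∈ A ×ˢ A | z.1 - z.2 = t * w.1.2 / w.1.1 - t * w.2 / p₀} : ℝ) ≤ #A := by
          exact_mod_cast card_difference_le A _
        have : (0 : ℝ) ≤ #A / (18 * K ^ 2) := by positivity
        linarith
      · rw [hT, mem_filter, not_and, not_le] at hwT
        have := hwT hw
        linarith
    rw [e1]
    calc _ ≤ _ := sum_le_sum e2
      _ = #T * #A + #P ^ 3 * (#A / (18 * K ^ 2)) := by
        rw [sum_add_distrib, sum_const, ← sum_filter, sum_const, card_product, card_product, hQP,
          filter_mem_eq_inter, inter_eq_right.2 (filter_subset _ _), nsmul_eq_mul, nsmul_eq_mul]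
        push_cast
        ring
      _ ≤ #P ^ 3 / (18 * K ^ 2) * #A + #P ^ 3 * (#A / (18 * K ^ 2)) := by gcongr
      _ = _ := by
        field_simp
        ring
  have hsq : ∑ a ∈ A, h a ^ 2 ≤ #P * (#A * #P ^ 3 / (9 * K ^ 2)) := by
    calc ∑ a ∈ A, h a ^ 2 = ∑ p₀ ∈ P, ∑ a ∈ A, h a * g p₀ a := by
          rw [sum_comm]
          refine sum_congr rfl fun a _ => ?_
          rw [← mul_sum, sq]
      _ ≤ ∑ p₀ ∈ P, (#A * #P ^ 3 / (9 * K ^ 2) : ℝ) := sum_le_sum hG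
      _ = _ := by simp
  rw [hN]
  have hcs := sq_sum_le_card_mul_sum_sq (s := A) (f := h)
  refine le_of_sq_le_sq ?_ (by positivity)
  calc _ ≤ _ := hcs
    _ ≤ #A * (#P * (#A * #P ^ 3 / (9 * K ^ 2))) := by gcongr
    _ = _ := by
      field_simp
      norm_num

lemma exists_initial_subset (S : Finset ℝ) (m : ℕ) (hm : m ≤ #S) :
    ∃ C ⊆ S, #C = m ∧ ∀ c ∈ C, ∀ x ∈ S \ C, c < x := by
  induction m with
  | zero => exact ⟨∅, empty_subset _, by simp, by simp⟩
  | succ m ih =>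
    obtain ⟨C, hCS, hC, hlt⟩ := ih (by omega)
    have hne : (S \ C).Nonempty := by
      rw [← card_pos, card_sdiff_of_subset hCS]
      omega
    have hmem := min'_mem _ hne
    refine ⟨insert ((S \ C).min' hne) C, ?_, ?_, ?_⟩
    · exact insert_subset (mem_sdiff.1 hmem).1 hCS
    · rw [card_insert_of_notMem (mem_sdiff.1 hmem).2, hC]
    · intro c hc x hx
      simp only [mem_sdiff, mem_insert, not_or] at hx
      have hx' : x ∈ S \ C := mem_sdiff.2 ⟨hx.1, hx.2.2⟩
      rcases mem_insert.1 hc with rfl | hc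
      · exact lt_of_le_of_ne (min'_le _ _ hx') (Ne.symm hx.2.1)
      · exact hlt c hc x hx'

/-- If every `m`-element subset of `S` has at least `z` points of `W` whose value under `f` lies
strictly between its extreme elements, then disjoint intervals give `k * z ≤ #W` as soon as
`k * m ≤ #S`. -/
lemma mul_le_card_of_clusters {β : Type*} (f : β → ℝ) {m : ℕ} {z : ℝ} (k : ℕ) :
    ∀ (S : Finset ℝ) (W : Finset β), k * m ≤ #S →
      (∀ C ⊆ S, #C = m → z ≤ #{w ∈ W | (∃ c ∈ C, c < f w) ∧ ∃ c ∈ C, f w < c}) →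
      k * z ≤ #W := by
  classical
  induction k with
  | zero =>
    intro S W _ _
    simp
  | succ k ih =>
    intro S W hS h
    have hS' : k * m + m ≤ #S := by linarith
    obtain ⟨C, hCS, hC, hlt⟩ := exists_initial_subset S m (by omega)
    have h1 := h C hCS hC
    have h2 := ih (S \ C) {w ∈ W | ¬ ((∃ c ∈ C, c < f w) ∧ ∃ c ∈ C, f w < c)}
      (by rw [card_sdiff_of_subset hCS]; omega) (by
        intro C' hC' hC'm
        refine (h C' (hC'.trans sdiff_subset) hC'm).trans ?_
        norm_cast
        apply card_le_card
        intro w hw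
        simp only [mem_filter] at hw ⊢
        refine ⟨⟨hw.1, ?_⟩, hw.2⟩
        rintro ⟨-, c, hc, hwc⟩
        obtain ⟨c', hc', hcw⟩ := hw.2.1
        have := hlt c hc c' (hC' hc')
        linarith)
    have h3 := card_filter_add_card_filter_not (s := W)
      (fun w => (∃ c ∈ C, c < f w) ∧ ∃ c ∈ C, f w < c)
    rw [← h3]
    push_cast
    linarith

/-- Cauchy-Schwarz bound for the size of a union of images by the number of coincidences. -/
lemma sq_sum_card_le_card_mul_sum_coincidences {ι γ δ : Type*} [DecidableEq δ] (s : Finset ι)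
    (Ω : ι → Finset γ) (φ : ι → γ → δ) (Z : Finset δ) (h : ∀ i ∈ s, ∀ x ∈ Ω i, φ i x ∈ Z) :
    (∑ i ∈ s, #(Ω i)) ^ 2 ≤
      #Z * ∑ i ∈ s, ∑ k ∈ s, #{w ∈ Ω i ×ˢ Ω k | φ i w.1 = φ k w.2} := by
  have h1 : ∑ i ∈ s, #(Ω i) = ∑ z ∈ Z, ∑ i ∈ s, #{x ∈ Ω i | φ i x = z} := by
    rw [sum_comm]
    exact sum_congr rfl fun i hi => card_eq_sum_card_fiberwise (h i hi)
  have h2 : ∑ i ∈ s, ∑ k ∈ s, #{w ∈ Ω i ×ˢ Ω k | φ i w.1 = φ k w.2} =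
      ∑ z ∈ Z, (∑ i ∈ s, #{x ∈ Ω i | φ i x = z}) ^ 2 := by
    simp_rw [sq, sum_mul_sum]
    rw [sum_comm (s := Z)]
    refine sum_congr rfl fun i hi => ?_
    rw [sum_comm (s := Z)]
    refine sum_congr rfl fun k hk => ?_
    rw [card_eq_sum_card_fiberwise (f := fun w => φ i w.1) (t := Z)]
    · refine sum_congr rfl fun z _ => ?_
      rw [← card_product]
      congr 1
      ext ⟨x, y⟩
      simp only [mem_filter, mem_product]
      constructor
      · rintro ⟨⟨⟨hx, hy⟩, he⟩, hz⟩
        exact ⟨⟨hx, hz⟩, hy, he.symm.trans hz⟩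
      · rintro ⟨⟨hx, hz⟩, hy, hz'⟩
        exact ⟨⟨⟨hx, hy⟩, hz.trans hz'.symm⟩, hz⟩
    · intro w hw
      simp only [coe_filter, mem_product, Set.mem_ofPred_eq] at hw
      exact h i hi _ hw.1.1
  rw [h1, h2]
  exact sq_sum_le_card_mul_sum_sq

/-- A popular richness: many quotients `x` have at least `τ` representations as `a / b`. -/
lemma exists_rich_quotients (A : Finset ℝ) (hA : ∀ a ∈ A, 0 < a) (hne : A.Nonempty) :
    ∃ τ : ℕ, 1 ≤ τ ∧ τ ≤ #A ∧
      (#A : ℝ) ^ 2 ≤ (1 + Real.log #A) * (τ * #{x ∈ A / A | τ ≤ #{b ∈ A | x * b ∈ A}}) := by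
  by_contra! hcon
  have hA0 : (0 : ℝ) < #A := by exact_mod_cast card_pos.2 hne
  have hlog : 0 ≤ Real.log #A := Real.log_natCast_nonneg _
  have hL : 0 < 1 + Real.log #A := by linarith
  have h1 : #A ^ 2 = ∑ x ∈ A / A, #{b ∈ A | x * b ∈ A} := by
    rw [sq, ← card_product, card_eq_sum_card_fiberwise (f := fun w => w.1 / w.2) (t := A / A)]
    · refine sum_congr rfl fun x hx => ?_
      apply card_bij' (fun w _ => w.2) (fun b _ => (x * b, b))
      · rintro ⟨a, b⟩ hw
        simp only [mem_filter, mem_product] at hw ⊢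
        obtain ⟨⟨ha, hb⟩, rfl⟩ := hw
        refine ⟨hb, ?_⟩
        rwa [div_mul_cancel₀ _ (hA b hb).ne']
      · intro b hb
        simp only [mem_filter, mem_product] at hb ⊢
        exact ⟨⟨hb.2, hb.1⟩, mul_div_cancel_right₀ _ (hA b hb.1).ne'⟩
      · rintro ⟨a, b⟩ hw
        simp only [mem_filter, mem_product] at hw ⊢
        obtain ⟨⟨ha, hb⟩, rfl⟩ := hw
        rw [div_mul_cancel₀ _ (hA b hb).ne']
      · intro b hb
        rfl
    · rintro ⟨a, b⟩ hw
      simp only [coe_product, Set.mem_prod, mem_coe] at hw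
      exact mem_coe.2 (div_mem_div hw.1 hw.2)
  have h2 : ∀ x, #{b ∈ A | x * b ∈ A} =
      ∑ τ ∈ Icc 1 #A, if τ ≤ #{b ∈ A | x * b ∈ A} then 1 else 0 := by
    intro x
    have hle : #{b ∈ A | x * b ∈ A} ≤ #A := card_filter_le _ _
    rw [← card_filter]
    have : {τ ∈ Icc 1 #A | τ ≤ #{b ∈ A | x * b ∈ A}} = Icc 1 #{b ∈ A | x * b ∈ A} := by
      ext τ
      simp only [mem_filter, mem_Icc]
      omega
    rw [this, Nat.card_Icc, Nat.add_sub_cancel]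
  have h3 : #A ^ 2 = ∑ τ ∈ Icc 1 #A, #{x ∈ A / A | τ ≤ #{b ∈ A | x * b ∈ A}} := by
    rw [h1, sum_congr rfl fun x _ => h2 x, sum_comm]
    exact sum_congr rfl fun τ _ => (card_filter _ _).symm
  have h4 : ∀ τ ∈ Icc 1 #A, (#{x ∈ A / A | τ ≤ #{b ∈ A | x * b ∈ A}} : ℝ) <
      (#A : ℝ) ^ 2 / (1 + Real.log #A) * (τ : ℝ)⁻¹ := by
    intro τ hτ
    rw [mem_Icc] at hτ
    have hτ0 : (0 : ℝ) < τ := by exact_mod_cast hτ.1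
    have := hcon τ hτ.1 hτ.2
    rw [← div_eq_mul_inv, lt_div_iff₀ hτ0, lt_div_iff₀ hL]
    linarith
  have h5 : (#A : ℝ) ^ 2 < ∑ τ ∈ Icc 1 #A, (#A : ℝ) ^ 2 / (1 + Real.log #A) * (τ : ℝ)⁻¹ := by
    have h3' : (#A : ℝ) ^ 2 = ∑ τ ∈ Icc 1 #A, (#{x ∈ A / A | τ ≤ #{b ∈ A | x * b ∈ A}} : ℝ) := by
      exact_mod_cast h3
    rw [h3']
    apply sum_lt_sum_of_nonempty
    · exact nonempty_Icc.2 (card_pos.2 hne)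
    · rwa [← h3']
  have h6 : ∑ τ ∈ Icc 1 #A, (τ : ℝ)⁻¹ ≤ 1 + Real.log #A := by
    have := harmonic_le_one_add_log #A
    rw [harmonic_eq_sum_Icc] at this
    simpa only [Rat.cast_sum, Rat.cast_inv, Rat.cast_natCast] using this
  rw [← mul_sum] at h5
  have : (#A : ℝ) ^ 2 / (1 + Real.log #A) * ∑ τ ∈ Icc 1 #A, (τ : ℝ)⁻¹ ≤ (#A : ℝ) ^ 2 := by
    rw [div_mul_eq_mul_div, div_le_iff₀ hL]
    exact mul_le_mul_of_nonneg_left h6 (sq_nonneg _)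
  linarith

/-- The sum of the point of abscissa `w.1 * p i` on the line of slope `i` through the origin and
the point of abscissa `w.2` on the line of slope `j`. -/
def lineSum (p : ℝ → ℝ) (i j : ℝ) (w : ℝ × ℝ) : ℝ × ℝ :=
  (w.1 * p i + w.2, i * (w.1 * p i) + j * w.2)

/-- Pairs of representations of the same point as sums of points on the lines of slopes `i`, `j`
and on the lines of slopes `k`, `l`. -/
noncomputable def coincidences (A : Finset ℝ) (p : ℝ → ℝ) (Q : ℝ → Finset ℝ) (i j k l : ℝ) :
    Finset ((ℝ × ℝ) × ℝ × ℝ) :=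
  {w ∈ (A ×ˢ Q j) ×ˢ (A ×ˢ Q l) | lineSum p i j w.1 = lineSum p k l w.2}

lemma mem_coincidences {A : Finset ℝ} {p : ℝ → ℝ} {Q : ℝ → Finset ℝ} {i j k l a q a' q' : ℝ} :
    ((a, q), (a', q')) ∈ coincidences A p Q i j k l ↔
      ((a ∈ A ∧ q ∈ Q j) ∧ a' ∈ A ∧ q' ∈ Q l) ∧
        a * p i + q = a' * p k + q' ∧ i * (a * p i) + j * q = k * (a' * p k) + l * q' := by
  simp [coincidences, lineSum]

section

variable {A : Finset ℝ} {p : ℝ → ℝ} {Q : ℝ → Finset ℝ} {i j k l : ℝ}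

lemma card_coincidences_diagonal_le (hp : p i ≠ 0) (hij : i ≠ j) :
    #(coincidences A p Q i j i j) ≤ #A * #(Q j) := by
  rw [← card_product]
  apply card_le_card_of_injOn Prod.fst
  · rintro ⟨⟨a, q⟩, a', q'⟩ hw
    rw [mem_coe, mem_coincidences] at hw
    exact mem_coe.2 (mem_product.2 hw.1.1)
  · rintro ⟨⟨a, q⟩, a', q'⟩ hw ⟨⟨b, r⟩, b', r'⟩ hw' h
    rw [mem_coe, mem_coincidences] at hw hw'
    simp only [Prod.mk.injEq] at h ⊢
    obtain ⟨rfl, rfl⟩ := h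
    have hq : q' = r' := by
      apply mul_left_cancel₀ (sub_ne_zero.2 hij)
      linear_combination i * hw'.2.1 - i * hw.2.1 - hw'.2.2 + hw.2.2
    refine ⟨⟨rfl, rfl⟩, ?_, hq⟩
    apply mul_right_cancel₀ hp
    linear_combination hw'.2.1 - hw.2.1 - hq

lemma card_coincidences_same_left_le (hp : p i ≠ 0) (hil : i ≠ l) :
    #(coincidences A p Q i j i l) ≤ #{w ∈ A ×ˢ Q j | w.1 + (j - l) / (l - i) * w.2 / p i ∈ A} := by
  have hli : l - i ≠ 0 := sub_ne_zero.2 hil.symm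
  apply card_le_card_of_injOn (fun w => (w.2.1, w.1.2))
  · rintro ⟨⟨a, q⟩, a', q'⟩ hw
    rw [mem_coe, mem_coincidences] at hw
    simp only [coe_filter, mem_product, Set.mem_ofPred_eq]
    refine ⟨⟨hw.1.2.1, hw.1.1.2⟩, ?_⟩
    have e : a' + (j - l) / (l - i) * q / p i = a := by
      field_simp
      linear_combination -l * hw.2.1 + hw.2.2
    rw [e]
    exact hw.1.1.1
  · rintro ⟨⟨a, q⟩, a', q'⟩ hw ⟨⟨b, r⟩, b', r'⟩ hw' h
    rw [mem_coe, mem_coincidences] at hw hw'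
    simp only [Prod.mk.injEq] at h ⊢
    obtain ⟨rfl, rfl⟩ := h
    have hq : q' = r' := by
      apply mul_left_cancel₀ hli
      linear_combination i * hw.2.1 - i * hw'.2.1 + hw'.2.2 - hw.2.2
    refine ⟨⟨?_, rfl⟩, rfl, hq⟩
    apply mul_right_cancel₀ hp
    linear_combination hw.2.1 - hw'.2.1 + hq

lemma card_coincidences_le_linear (hp : p i ≠ 0) (hij : i ≠ j) :
    #(coincidences A p Q i j k l) ≤
      #{w ∈ A ×ˢ Q l | (k - i) * p k / (j - i) * w.1 + (l - i) / (j - i) * w.2 ∈ Q j} := by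
  have hji : j - i ≠ 0 := sub_ne_zero.2 hij.symm
  apply card_le_card_of_injOn Prod.snd
  · rintro ⟨⟨a, q⟩, a', q'⟩ hw
    rw [mem_coe, mem_coincidences] at hw
    simp only [coe_filter, mem_product, Set.mem_ofPred_eq]
    refine ⟨hw.1.2, ?_⟩
    have e : (k - i) * p k / (j - i) * a' + (l - i) / (j - i) * q' = q := by
      field_simp
      linear_combination i * hw.2.1 - hw.2.2
    rw [e]
    exact hw.1.1.2
  · rintro ⟨⟨a, q⟩, a', q'⟩ hw ⟨⟨b, r⟩, b', r'⟩ hw' h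
    rw [mem_coe, mem_coincidences] at hw hw'
    simp only [Prod.mk.injEq] at h ⊢
    obtain ⟨rfl, rfl⟩ := h
    have hq : q = r := by
      apply mul_left_cancel₀ hji
      linear_combination i * hw'.2.1 - i * hw.2.1 - hw'.2.2 + hw.2.2
    refine ⟨⟨?_, hq⟩, rfl, rfl⟩
    apply mul_right_cancel₀ hp
    linear_combination hw.2.1 - hw'.2.1 - hq

lemma card_coincidences_le_mul (hpi : p i ≠ 0) (hpk : p k ≠ 0) (hik : i ≠ k) :
    #(coincidences A p Q i j k l) ≤ #(Q j) * #(Q l) := by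
  rw [← card_product]
  apply card_le_card_of_injOn (fun w => (w.1.2, w.2.2))
  · rintro ⟨⟨a, q⟩, a', q'⟩ hw
    rw [mem_coe, mem_coincidences] at hw
    exact mem_coe.2 (mem_product.2 ⟨hw.1.1.2, hw.1.2.2⟩)
  · rintro ⟨⟨a, q⟩, a', q'⟩ hw ⟨⟨b, r⟩, b', r'⟩ hw' h
    rw [mem_coe, mem_coincidences] at hw hw'
    simp only [Prod.mk.injEq] at h ⊢
    obtain ⟨rfl, rfl⟩ := h
    have ha' : a' = b' := by
      apply mul_right_cancel₀ hpk
      apply mul_left_cancel₀ (sub_ne_zero.2 hik)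
      linear_combination i * hw'.2.1 - i * hw.2.1 - hw'.2.2 + hw.2.2
    refine ⟨⟨?_, rfl⟩, ha', rfl⟩
    apply mul_right_cancel₀ hpi
    linear_combination hw.2.1 - hw'.2.1 + p k * ha'

lemma sum_card_coincidences_same_left_le (I : Finset ℝ) (hp : ∀ i ∈ I, p i ≠ 0)
    (hQ : ∀ q ∈ Q j, 0 < q) (hjl : j ≠ l) :
    ∑ i ∈ I, #(coincidences A p Q i j i l) ≤ #A * (#(Q j) * #(Q l)) := by
  rw [← card_sigma, ← card_product, ← card_product]
  apply card_le_card_of_injOn (fun w => (w.2.1.1, (w.2.1.2, w.2.2.2)))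
  · rintro ⟨i, ⟨a, q⟩, a', q'⟩ hw
    rw [mem_coe, mem_sigma, mem_coincidences] at hw
    simp only [coe_product, Set.mem_prod, mem_coe]
    exact ⟨hw.2.1.1.1, hw.2.1.1.2, hw.2.1.2.2⟩
  · rintro ⟨i, ⟨a, q⟩, a', q'⟩ hw ⟨k, ⟨b, r⟩, b', r'⟩ hw' h
    rw [mem_coe, mem_sigma, mem_coincidences] at hw hw'
    simp only [Prod.mk.injEq] at h
    simp only at hw hw'
    obtain ⟨rfl, rfl, rfl⟩ := h
    have hqq : q' - q ≠ 0 := by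
      intro h0
      have hq := hQ q hw.2.1.1.2
      have : (j - l) * q = 0 := by
        linear_combination -i * hw.2.2.1 + hw.2.2.2 + (l - i) * h0
      rcases mul_eq_zero.1 this with h1 | h1
      · exact hjl (sub_eq_zero.1 h1)
      · exact hq.ne' h1
    have hik : i = k := by
      apply mul_left_cancel₀ hqq
      linear_combination k * hw'.2.2.1 - i * hw.2.2.1 + hw.2.2.2 - hw'.2.2.2
    subst hik
    have ha' : a' = b' := by
      apply mul_right_cancel₀ (hp i hw.1)
      linear_combination hw'.2.2.1 - hw.2.2.1
    subst ha'
    rfl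

end

/-- Few coincidences between sums of points on lines with slopes in `I` and `J` force many
distinct sums. -/
lemma mul_le_card_of_few_coincidences (A I J : Finset ℝ) (p : ℝ → ℝ) (Q : ℝ → Finset ℝ)
    (Z : Finset (ℝ × ℝ)) {M τ : ℕ} {K : ℝ} (hA : A.Nonempty) (hτ : 0 < τ) (hM : 0 < M)
    (hK : 0 < K) (hI : #I = M) (hJ : #J = M) (hIJ : Disjoint I J)
    (hp : ∀ i ∈ I, p i ≠ 0) (hQ : ∀ j ∈ J, #(Q j) = τ)
    (hZ : ∀ i ∈ I, ∀ j ∈ J, ∀ w ∈ A ×ˢ Q j, lineSum p i j w ∈ Z) (hMK : 3 * K ≤ M)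
    (hX : ∀ i ∈ I, ∀ j ∈ J, ∀ k ∈ I, ∀ l ∈ J, i ≠ k →
      (#(coincidences A p Q i j k l) : ℝ) ≤ #A * τ / (3 * K * M))
    (hY : ∑ i ∈ I, ∑ j ∈ J, ∑ l ∈ J,
      (if j ≠ l then (#(coincidences A p Q i j i l) : ℝ) else 0) ≤ M ^ 3 * #A * τ / (3 * K)) :
    K * M * #A * τ ≤ #Z := by
  have hA0 : (0 : ℝ) < #A := by exact_mod_cast card_pos.2 hA
  have hτ0 : (0 : ℝ) < τ := by exact_mod_cast hτ
  have hM0 : (0 : ℝ) < M := by exact_mod_cast hM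
  have hcs := sq_sum_card_le_card_mul_sum_coincidences (I ×ˢ J) (fun w => A ×ˢ Q w.2)
    (fun w => lineSum p w.1 w.2) Z (by
      rintro ⟨i, j⟩ hij x hx
      rw [mem_product] at hij
      exact hZ i hij.1 j hij.2 x hx)
  have hcs' : ((M : ℝ) ^ 2 * #A * τ) ^ 2 ≤ #Z * ∑ i ∈ I, ∑ j ∈ J, ∑ k ∈ I, ∑ l ∈ J,
      (#(coincidences A p Q i j k l) : ℝ) := by
    have e : ∑ w ∈ I ×ˢ J, #(A ×ˢ Q w.2) = M ^ 2 * #A * τ := by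
      rw [sum_product]
      have : ∀ i ∈ I, ∑ j ∈ J, #(A ×ˢ Q j) = M * (#A * τ) := by
        intro i _
        rw [sum_congr rfl fun j hj => by rw [card_product, hQ j hj], sum_const, hJ, smul_eq_mul]
      rw [sum_congr rfl this, sum_const, hI, smul_eq_mul]
      ring
    rw [e] at hcs
    simp only [sum_product] at hcs
    exact_mod_cast hcs
  have hbound : ∀ i ∈ I, ∀ j ∈ J, ∀ k ∈ I, ∀ l ∈ J,
      (#(coincidences A p Q i j k l) : ℝ) ≤ #A * τ / (3 * K * M) +
        (if i = k then (if j = l then (#A * τ : ℝ) else 0) +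
          (if j ≠ l then (#(coincidences A p Q i j i l) : ℝ) else 0) else 0) := by
    intro i hi j hj k hk l hl
    have h0 : (0 : ℝ) ≤ #A * τ / (3 * K * M) := by positivity
    by_cases hik : i = k
    · subst hik
      by_cases hjl : j = l
      · subst hjl
        have hij : i ≠ j := fun h => disjoint_left.1 hIJ hi (h ▸ hj)
        have h1 := card_coincidences_diagonal_le (A := A) (Q := Q) (hp i hi) hij
        rw [hQ j hj] at h1
        have h1' : (#(coincidences A p Q i j i j) : ℝ) ≤ #A * τ := by exact_mod_cast h1
        simp only [if_true, ne_eq, not_true, if_false]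
        linarith
      · simp only [if_true, hjl, if_false, ne_eq, not_false_eq_true]
        linarith
    · simp only [hik, if_false, add_zero]
      exact hX i hi j hj k hk l hl hik
  have hE : ∑ i ∈ I, ∑ j ∈ J, ∑ k ∈ I, ∑ l ∈ J, (#(coincidences A p Q i j k l) : ℝ) ≤
      M ^ 3 * #A * τ / K := by
    calc _ ≤ ∑ i ∈ I, ∑ j ∈ J, ∑ k ∈ I, ∑ l ∈ J, (#A * τ / (3 * K * M) +
        (if i = k then (if j = l then (#A * τ : ℝ) else 0) +
          (if j ≠ l then (#(coincidences A p Q i j i l) : ℝ) else 0) else 0)) :=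
        sum_le_sum fun i hi => sum_le_sum fun j hj => sum_le_sum fun k hk =>
          sum_le_sum fun l hl => hbound i hi j hj k hk l hl
      _ = M ^ 4 * (#A * τ / (3 * K * M)) + M ^ 2 * (#A * τ) + ∑ i ∈ I, ∑ j ∈ J, ∑ l ∈ J,
          (if j ≠ l then (#(coincidences A p Q i j i l) : ℝ) else 0) := by
        have e1 : ∀ i ∈ I, ∀ j ∈ J, ∑ k ∈ I, ∑ l ∈ J, (#A * τ / (3 * K * M) +
            (if i = k then (if j = l then (#A * τ : ℝ) else 0) +
              (if j ≠ l then (#(coincidences A p Q i j i l) : ℝ) else 0) else 0)) =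
            M ^ 2 * (#A * τ / (3 * K * M)) + #A * τ + ∑ l ∈ J,
              (if j ≠ l then (#(coincidences A p Q i j i l) : ℝ) else 0) := by
          intro i hi j hj
          rw [sum_comm]
          simp only [sum_add_distrib, sum_const, hI, sum_ite_eq, hi, hj, hJ, if_true,
            nsmul_eq_mul]
          ring
        rw [sum_congr rfl fun i hi => sum_congr rfl fun j hj => e1 i hi j hj]
        simp only [sum_add_distrib, sum_const, hI, hJ, nsmul_eq_mul]
        ring
      _ ≤ M ^ 4 * (#A * τ / (3 * K * M)) + M ^ 2 * (#A * τ) + M ^ 3 * #A * τ / (3 * K) := by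
        gcongr
      _ ≤ M ^ 4 * (#A * τ / (3 * K * M)) + M ^ 2 * (M / (3 * K) * #A * τ) +
          M ^ 3 * #A * τ / (3 * K) := by
        have : 1 ≤ M / (3 * K) := by
          rw [le_div_iff₀ (by positivity)]
          linarith
        have h2 : (#A * τ : ℝ) ≤ M / (3 * K) * #A * τ := by
          rw [mul_assoc]
          exact le_mul_of_one_le_left (by positivity) this
        gcongr
      _ = _ := by
        field_simp
        ring
  have h1 : ((M : ℝ) ^ 2 * #A * τ) ^ 2 ≤ #Z * (M ^ 3 * #A * τ / K) :=
    hcs'.trans (by gcongr)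
  have h2 : (K * M * #A * τ) * (M ^ 3 * #A * τ / K) ≤ #Z * (M ^ 3 * #A * τ / K) := by
    refine le_trans (le_of_eq ?_) h1
    field_simp
  exact le_of_mul_le_mul_right h2 (by positivity)

/-- Slope clusters of rich lines with few points per line produce many sums. -/
lemma cluster_card_le_of_small_richness (A C : Finset ℝ) (P : ℝ → Finset ℝ) (Z : Finset (ℝ × ℝ))
    {M τ : ℕ} {K : ℝ} (hA : A.Nonempty) (hτ : 0 < τ) (hM : 0 < M) (hK : 0 < K)
    (hC : #C = 2 * M) (hP : ∀ x ∈ C, ∀ p ∈ P x, 0 < p) (hPτ : ∀ x ∈ C, #(P x) = τ)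
    (hZ : ∀ i ∈ C, ∀ j ∈ C, i ≠ j → ∀ a ∈ A, ∀ p ∈ P i, ∀ q ∈ P j,
      (a * p + q, i * (a * p) + j * q) ∈ Z)
    (hMK : 3 * K * τ ≤ M) (hMA : 3 * K * M * τ ≤ #A) :
    K * M * #A * τ ≤ #Z := by
  obtain ⟨I, hIC, hI⟩ := exists_subset_card_eq (s := C) (n := M) (by omega)
  have hne : ∀ x ∈ C, ∃ p, p ∈ P x := fun x hx => card_pos.1 (by rw [hPτ x hx]; exact hτ)
  choose! p hp using hne
  have hM0 : (0 : ℝ) < M := by exact_mod_cast hM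
  have hτ1 : (1 : ℝ) ≤ τ := by exact_mod_cast hτ
  have hJC : C \ I ⊆ C := sdiff_subset
  have hdisj : Disjoint I (C \ I) := disjoint_sdiff
  have hp0 : ∀ i ∈ I, p i ≠ 0 := fun i hi => (hP i (hIC hi) _ (hp i (hIC hi))).ne'
  have hJ : #(C \ I) = M := by
    rw [card_sdiff_of_subset hIC]
    omega
  refine mul_le_card_of_few_coincidences A I (C \ I) p P Z hA hτ hM hK hI hJ hdisj
    hp0 (fun j hj => hPτ j (hJC hj)) ?_ (by nlinarith) ?_ ?_
  · rintro i hi j hj ⟨a, q⟩ hw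
    rw [mem_product] at hw
    exact hZ i (hIC hi) j (hJC hj) (fun h => disjoint_left.1 hdisj hi (h ▸ hj)) a hw.1 _
      (hp i (hIC hi)) q hw.2
  · intro i hi j hj k hk l hl hik
    have h := card_coincidences_le_mul (A := A) (Q := P) (j := j) (l := l) (hp0 i hi)
      (hp0 k hk) hik
    rw [hPτ j (hJC hj), hPτ l (hJC hl)] at h
    have h' : (#(coincidences A p P i j k l) : ℝ) ≤ τ * τ := by exact_mod_cast h
    refine h'.trans ?_
    rw [le_div_iff₀ (by positivity)]
    calc (τ * τ * (3 * K * M) : ℝ) = 3 * K * M * τ * τ := by ring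
      _ ≤ _ := by gcongr
  · have hjl : ∀ j ∈ C \ I, ∀ l ∈ C \ I, ∑ i ∈ I,
        (if j ≠ l then (#(coincidences A p P i j i l) : ℝ) else 0) ≤ #A * (τ * τ) := by
      intro j hj l hl
      by_cases h : j = l
      · simp only [h, ne_eq, not_true, if_false, sum_const_zero]
        positivity
      · simp only [h, ne_eq, not_false_eq_true, if_true]
        have := sum_card_coincidences_same_left_le (A := A) (Q := P) I hp0 (hP j (hJC hj)) h
        rw [hPτ j (hJC hj), hPτ l (hJC hl)] at this
        exact_mod_cast this
    have e : ∑ i ∈ I, ∑ j ∈ C \ I, ∑ l ∈ C \ I,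
        (if j ≠ l then (#(coincidences A p P i j i l) : ℝ) else 0) =
        ∑ j ∈ C \ I, ∑ l ∈ C \ I, ∑ i ∈ I,
          (if j ≠ l then (#(coincidences A p P i j i l) : ℝ) else 0) := by
      rw [sum_comm]
      exact sum_congr rfl fun j _ => sum_comm
    rw [e]
    calc _ ≤ ∑ j ∈ C \ I, ∑ l ∈ C \ I, (#A * (τ * τ) : ℝ) :=
          sum_le_sum fun j hj => sum_le_sum fun l hl => hjl j hj l hl
      _ = M ^ 2 * #A * τ * τ := by
        simp only [sum_const, hJ, nsmul_eq_mul]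
        ring
      _ ≤ M ^ 2 * #A * τ * (M / (3 * K)) := by
        gcongr
        rw [le_div_iff₀ (by positivity)]
        linarith
      _ = _ := by
        field_simp

lemma card_coincidences_le_of_large_richness (A : Finset ℝ) (P : ℝ → Finset ℝ) (p : ℝ → ℝ)
    {i j k l K : ℝ} {τ : ℕ} (hK : 1000 ≤ K) (hAK : (#A : ℝ) = K ^ 100)
    (hAτ : (#A : ℝ) ≤ 16 * K ^ 2 * τ ^ 2) (hτ : 0 < τ) (hPk : ∀ q ∈ P k, 0 < q)
    (hPj : #(P j) = τ) (hPkτ : #(P k) = τ) (hPl : #(P l) = τ)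
    (hAP : (#(A * P k) : ℝ) ≤ K * #A)
    (hpi : p i ≠ 0) (hpk : p k ≠ 0) (hij : i ≠ j) (hik : i ≠ k) (hil : i ≠ l) :
    (#(coincidences A p P i j k l) : ℝ) ≤ #A * τ / (12 * K ^ 2) := by
  have hK1 : 1 ≤ K := by linarith
  have hK0 : 0 < K := by linarith
  have hτ0 : (0 : ℝ) < τ := by exact_mod_cast hτ
  have hKτ : K ^ 49 ≤ 4 * τ := by
    refine le_of_sq_le_sq ?_ (by positivity)
    rw [hAK] at hAτ
    have : K ^ 2 * (K ^ 49) ^ 2 ≤ K ^ 2 * (4 * τ) ^ 2 := by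
      calc _ = K ^ 100 := by ring
        _ ≤ _ := hAτ
        _ = _ := by ring
    exact le_of_mul_le_mul_left this (by positivity)
  have hK49 : K ≤ K ^ 49 := le_self_pow₀ hK1 (by norm_num)
  have hρ1 : 1 ≤ 40 * τ / K ^ 49 := by
    rw [le_div_iff₀ (by positivity)]
    linarith
  have hρ2 : 40 * τ / K ^ 49 ≤ τ := by
    rw [div_le_iff₀ (by positivity)]
    nlinarith
  have hji : j - i ≠ 0 := sub_ne_zero.2 hij.symm
  have h1 := card_linear_solutions_mul_card_le A (P k) (P l) (P j) hPk
    (α := (k - i) * p k / (j - i)) (β := (l - i) / (j - i))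
    (div_ne_zero (mul_ne_zero (sub_ne_zero.2 hik.symm) hpk) hji)
    (div_ne_zero (sub_ne_zero.2 hil.symm) hji) hρ1 hρ2 hρ2 (by rw [hPkτ]) (by rw [hPj])
  have h2 : (#(coincidences A p P i j k l) : ℝ) ≤ _ :=
    Nat.cast_le.2 (card_coincidences_le_linear (A := A) (Q := P) (k := k) (l := l) hpi hij)
  rw [hPkτ, hPl] at h1
  have h3 : (#(coincidences A p P i j k l) : ℝ) * τ ≤ #A * τ / (12 * K ^ 2) * τ := by
    calc _ ≤ _ := mul_le_mul_of_nonneg_right h2 hτ0.le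
      _ ≤ _ := h1
      _ ≤ 2 * (40 * τ / K ^ 49) * (K * K ^ 100 * τ) +
          64 * τ ^ 2 * τ ^ 2 / (40 * τ / K ^ 49) ^ 2 := by
        rw [← hAK]
        gcongr
      _ = (80 * K ^ 52 + K ^ 98 / 25) * τ ^ 2 := by
        field_simp
        ring
      _ ≤ (K ^ 98 / 12) * τ ^ 2 := by
        gcongr
        have : 1000 ^ 2 * K ^ 52 ≤ K ^ 98 := by
          calc 1000 ^ 2 * K ^ 52 ≤ K ^ 2 * K ^ 52 := by gcongr
            _ = K ^ 54 := by ring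
            _ ≤ K ^ 98 := pow_le_pow_right₀ hK1 (by norm_num)
        have h52 : 0 < K ^ 52 := by positivity
        linarith
      _ = _ := by
        rw [hAK]
        field_simp
  exact le_of_mul_le_mul_right h3 hτ0

lemma exists_multiplier_few_coincidences (A J : Finset ℝ) (P : ℝ → Finset ℝ) {i K : ℝ} {M τ : ℕ}
    (hK : 1000 ≤ K) (hAK : (#A : ℝ) = K ^ 100) (hAτ : (#A : ℝ) ≤ 16 * K ^ 2 * τ ^ 2)
    (hτ : 0 < τ) (hτA : τ ≤ #A) (hPi : ∀ q ∈ P i, 0 < q) (hPiτ : #(P i) = τ)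
    (hJ : #J = M) (hPj : ∀ j ∈ J, #(P j) = τ) (hAP : (#(A * P i) : ℝ) ≤ K * #A) (hiJ : i ∉ J) :
    ∃ x ∈ P i, ∑ j ∈ J, ∑ l ∈ J, (if j ≠ l then
      (#{w ∈ A ×ˢ P j | w.1 + (j - l) / (l - i) * w.2 / x ∈ A} : ℝ) else 0) ≤
        M ^ 2 * #A * τ / (3 * K) := by
  have hK1 : 1 ≤ K := by linarith
  have hK0 : 0 < K := by linarith
  have hτ0 : (0 : ℝ) < τ := by exact_mod_cast hτ
  have hKτ : K ^ 40 ≤ τ := by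
    refine le_of_sq_le_sq ?_ (by positivity)
    rw [hAK] at hAτ
    have : (16 * K ^ 2) * (K ^ 40) ^ 2 ≤ (16 * K ^ 2) * τ ^ 2 := by
      calc 16 * K ^ 2 * (K ^ 40) ^ 2 ≤ K * K ^ 2 * (K ^ 40) ^ 2 := by
            gcongr
            linarith
        _ = K ^ 83 := by ring
        _ ≤ K ^ 100 := pow_le_pow_right₀ hK1 (by norm_num)
        _ ≤ _ := hAτ
    exact le_of_mul_le_mul_left this (by positivity)
  apply exists_le_of_sum_le (card_pos.1 (by rw [hPiτ]; exact hτ))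
  have hjl : ∀ j ∈ J, ∀ l ∈ J, ∑ x ∈ P i, (if j ≠ l then
      (#{w ∈ A ×ˢ P j | w.1 + (j - l) / (l - i) * w.2 / x ∈ A} : ℝ) else 0) ≤
        #A * τ ^ 2 / (3 * K) := by
    intro j hj l hl
    by_cases h : j = l
    · simp only [h, ne_eq, not_true, if_false, sum_const_zero]
      positivity
    · simp only [h, ne_eq, not_false_eq_true, if_true]
      have hli : l - i ≠ 0 := sub_ne_zero.2 (fun h => hiJ (h ▸ hl))
      have := card_dilated_differences_le A (P i) (P j) hPi (K := K)
        (t := (j - l) / (l - i)) (div_ne_zero (sub_ne_zero.2 h) hli) hK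
        (by rw [hPiτ, hPj j hj]) hAP (by rwa [hPiτ]) (by rwa [hPiτ]) (by rwa [hPiτ])
      rwa [hPiτ] at this
  calc _ = ∑ j ∈ J, ∑ l ∈ J, ∑ x ∈ P i, (if j ≠ l then
        (#{w ∈ A ×ˢ P j | w.1 + (j - l) / (l - i) * w.2 / x ∈ A} : ℝ) else 0) := by
        rw [sum_comm]
        exact sum_congr rfl fun j _ => sum_comm
    _ ≤ ∑ j ∈ J, ∑ l ∈ J, (#A * τ ^ 2 / (3 * K) : ℝ) :=
        sum_le_sum fun j hj => sum_le_sum fun l hl => hjl j hj l hl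
    _ = ∑ x ∈ P i, (M ^ 2 * #A * τ / (3 * K) : ℝ) := by
        simp only [sum_const, hJ, hPiτ, nsmul_eq_mul]
        ring

lemma cluster_card_le_of_large_richness (A C : Finset ℝ) (P : ℝ → Finset ℝ) (Z : Finset (ℝ × ℝ))
    {M τ : ℕ} {K : ℝ} (hA : A.Nonempty) (hτ : 0 < τ) (hτA : τ ≤ #A) (hM : 0 < M)
    (hK : 1000 ≤ K) (hAK : (#A : ℝ) = K ^ 100) (hAτ : (#A : ℝ) ≤ 16 * K ^ 2 * τ ^ 2)
    (hC : #C = 2 * M) (hP : ∀ x ∈ C, ∀ p ∈ P x, 0 < p) (hPτ : ∀ x ∈ C, #(P x) = τ)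
    (hAP : ∀ x ∈ C, (#(A * P x) : ℝ) ≤ K * #A)
    (hZ : ∀ i ∈ C, ∀ j ∈ C, i ≠ j → ∀ a ∈ A, ∀ p ∈ P i, ∀ q ∈ P j,
      (a * p + q, i * (a * p) + j * q) ∈ Z)
    (hMK : 3 * K ≤ M) (hMK' : M ≤ 4 * K) :
    K * M * #A * τ ≤ #Z := by
  have hK0 : 0 < K := by linarith
  have hM0 : (0 : ℝ) < M := by exact_mod_cast hM
  obtain ⟨I, hIC, hI⟩ := exists_subset_card_eq (s := C) (n := M) (by omega)
  have hJC : C \ I ⊆ C := sdiff_subset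
  have hdisj : Disjoint I (C \ I) := disjoint_sdiff
  have hJ : #(C \ I) = M := by
    rw [card_sdiff_of_subset hIC]
    omega
  have hex : ∀ i ∈ I, ∃ x ∈ P i, ∑ j ∈ C \ I, ∑ l ∈ C \ I, (if j ≠ l then
      (#{w ∈ A ×ˢ P j | w.1 + (j - l) / (l - i) * w.2 / x ∈ A} : ℝ) else 0) ≤
        M ^ 2 * #A * τ / (3 * K) := fun i hi =>
    exists_multiplier_few_coincidences A (C \ I) P hK hAK hAτ hτ hτA (hP i (hIC hi))
      (hPτ i (hIC hi)) hJ (fun j hj => hPτ j (hJC hj)) (hAP i (hIC hi)) (disjoint_left.1 hdisj hi)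
  choose! p hp hpsum using hex
  have hp0 : ∀ i ∈ I, p i ≠ 0 := fun i hi => (hP i (hIC hi) _ (hp i hi)).ne'
  have hne : ∀ i ∈ I, ∀ j ∈ C \ I, i ≠ j := fun i hi j hj h => disjoint_left.1 hdisj hi (h ▸ hj)
  refine mul_le_card_of_few_coincidences A I (C \ I) p P Z hA hτ hM hK0 hI hJ hdisj
    hp0 (fun j hj => hPτ j (hJC hj)) ?_ hMK ?_ ?_
  · rintro i hi j hj ⟨a, q⟩ hw
    rw [mem_product] at hw
    exact hZ i (hIC hi) j (hJC hj) (hne i hi j hj) a hw.1 _ (hp i hi) q hw.2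
  · intro i hi j hj k hk l hl hik
    refine (card_coincidences_le_of_large_richness A P p hK hAK hAτ hτ (hP k (hIC hk))
      (hPτ j (hJC hj)) (hPτ k (hIC hk)) (hPτ l (hJC hl)) (hAP k (hIC hk)) (hp0 i hi) (hp0 k hk)
      (hne i hi j hj) hik (hne i hi l hl)).trans ?_
    apply div_le_div_of_nonneg_left (by positivity) (by positivity)
    nlinarith
  · calc _ ≤ ∑ i ∈ I, (M ^ 2 * #A * τ / (3 * K) : ℝ) := by
          refine sum_le_sum fun i hi => le_trans ?_ (hpsum i hi)
          refine sum_le_sum fun j hj => sum_le_sum fun l hl => ?_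
          split_ifs with h
          · exact_mod_cast card_coincidences_same_left_le (A := A) (Q := P) (j := j) (hp0 i hi)
              (hne i hi l hl)
          · exact le_rfl
      _ = _ := by
        simp only [sum_const, hI, nsmul_eq_mul]
        ring

/-- A sum of points on two distinct lines through the origin has slope strictly between theirs. -/
lemma slope_between {C : Finset ℝ} {i j x y : ℝ} (hi : i ∈ C) (hj : j ∈ C) (hij : i ≠ j)
    (hx : 0 < x) (hy : 0 < y) :
    (∃ c ∈ C, c < (i * x + j * y) / (x + y)) ∧ ∃ c ∈ C, (i * x + j * y) / (x + y) < c := by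
  have hxy : 0 < x + y := by linarith
  rcases lt_or_gt_of_ne hij with h | h
  · refine ⟨⟨i, hi, ?_⟩, j, hj, ?_⟩
    · rw [lt_div_iff₀ hxy]
      nlinarith
    · rw [div_lt_iff₀ hxy]
      nlinarith
  · refine ⟨⟨j, hj, ?_⟩, i, hi, ?_⟩
    · rw [lt_div_iff₀ hxy]
      nlinarith
    · rw [div_lt_iff₀ hxy]
      nlinarith

lemma card_ge_of_rich_clusters {β : Type*} (f : β → ℝ) (S : Finset ℝ) (W : Finset β) {m τ : ℕ}
    {n K L : ℝ} (hm : 0 < m) (hτ : 0 < τ) (hL : 0 < L) (hn : 0 ≤ n) (hK : 0 ≤ K)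
    (hS : n ^ 2 ≤ 2 * L * τ * #S) (hmn : 2 * L * τ * m ≤ n ^ 2)
    (h : ∀ C ⊆ S, #C = m → K * n * τ * (m / 2) ≤
      #{w ∈ W | (∃ c ∈ C, c < f w) ∧ ∃ c ∈ C, f w < c}) :
    n ^ 3 * K / (8 * L) ≤ #W := by
  have hτ0 : (0 : ℝ) < τ := by exact_mod_cast hτ
  have hmS : m ≤ #S := by
    have : 2 * L * τ * m ≤ 2 * L * τ * #S := hmn.trans hS
    have := le_of_mul_le_mul_left this (by positivity)
    exact_mod_cast this
  have hk := mul_le_card_of_clusters f (#S / m) S W (Nat.div_mul_le_self _ _) h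
  have hdiv : #S ≤ 2 * (#S / m * m) := by
    have h1 := Nat.div_add_mod #S m
    have h2 := Nat.mod_lt #S hm
    have h3 : 1 ≤ #S / m := (Nat.one_le_div_iff hm).2 hmS
    nlinarith
  have hdiv' : (#S : ℝ) ≤ 2 * ((#S / m : ℕ) * m) := by exact_mod_cast hdiv
  refine le_trans ?_ hk
  rw [div_le_iff₀ (by positivity)]
  calc n ^ 3 * K = K * n * n ^ 2 := by ring
    _ ≤ K * n * (2 * L * τ * #S) := by gcongr
    _ ≤ K * n * (2 * L * τ * (2 * ((#S / m : ℕ) * m))) := by gcongr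
    _ = _ := by ring

/-- Adding the points of two lines of distinct slopes through the origin produces only distinct
sums. -/
lemma card_mul_card_le_of_two_lines (U Q : Finset ℝ) (Z : Finset (ℝ × ℝ)) {i j : ℝ} (hij : i ≠ j)
    (h : ∀ u ∈ U, ∀ q ∈ Q, (u + q, i * u + j * q) ∈ Z) : #U * #Q ≤ #Z := by
  rw [← card_product]
  refine card_le_card_of_injOn (fun z => (z.1 + z.2, i * z.1 + j * z.2)) ?_ ?_
  · rintro ⟨u, q⟩ hz
    have hz' := mem_product.1 (mem_coe.1 hz)
    exact h u hz'.1 q hz'.2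
  · rintro ⟨u, q⟩ - ⟨v, r⟩ - he
    simp only [Prod.mk.injEq] at he ⊢
    have h1 : (i - j) * (u - v) = 0 := by linear_combination he.2 - j * he.1
    have h2 : u = v := sub_eq_zero.1 ((mul_eq_zero.1 h1).resolve_left (sub_ne_zero.2 hij))
    exact ⟨h2, by linarith [he.1]⟩

/-- A quantitative lower bound for pairs of elements of `AA + A`. -/
lemma card_AA_add_A_sq_ge (A : Finset ℝ) (hA : ∀ a ∈ A, 0 < a) {K L : ℝ} (hK : 1000 ≤ K)
    (hAK : (#A : ℝ) = K ^ 100) (hAL : 1 + Real.log #A ≤ L) (hLK : L ≤ K) :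
    (#A : ℝ) ^ 3 * K / (8 * L) ≤
      (#((A ×ˢ A ×ˢ A).image (fun p : ℝ × ℝ × ℝ => p.1 * p.2.1 + p.2.2)) : ℝ) ^ 2 := by
  set T := (A ×ˢ A ×ˢ A).image (fun p : ℝ × ℝ × ℝ => p.1 * p.2.1 + p.2.2) with hT
  have hmem : ∀ a ∈ A, ∀ b ∈ A, ∀ c ∈ A, a * b + c ∈ T := fun a ha b hb c hc =>
    mem_image.2 ⟨(a, b, c), by simp [ha, hb, hc], rfl⟩
  have hK0 : 0 < K := by linarith
  have hn0 : (0 : ℝ) < #A := by rw [hAK]; positivity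
  have hne : A.Nonempty := card_pos.1 (by exact_mod_cast hn0)
  have hn3 : 16 * K ^ 2 ≤ #A := by
    rw [hAK]
    calc 16 * K ^ 2 ≤ K * K ^ 2 := by gcongr; linarith
      _ = K ^ 3 := by ring
      _ ≤ K ^ 100 := pow_le_pow_right₀ (by linarith) (by norm_num)
  have hL0 : 0 < L := by linarith [Real.log_natCast_nonneg #A]
  obtain ⟨τ, hτ, hτA, hrich⟩ := exists_rich_quotients A hA hne
  set S := {x ∈ A / A | τ ≤ #{b ∈ A | x * b ∈ A}} with hS
  have hτ1 : (1 : ℝ) ≤ τ := by exact_mod_cast hτ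
  have hτn : (τ : ℝ) ≤ #A := by exact_mod_cast hτA
  have hSn : (#A : ℝ) ^ 2 ≤ L * τ * #S := hrich.trans (by
    rw [mul_assoc]; gcongr)
  have hex : ∀ x ∈ S, ∃ Q ⊆ {b ∈ A | x * b ∈ A}, #Q = τ := fun x hx =>
    exists_subset_card_eq (mem_filter.1 hx).2
  choose! P hPsub hPτ using hex
  have hPA : ∀ x ∈ S, ∀ p ∈ P x, p ∈ A ∧ x * p ∈ A := fun x hx p hp =>
    mem_filter.1 (hPsub x hx hp)
  have hP0 : ∀ x ∈ S, ∀ p ∈ P x, 0 < p := fun x hx p hp => hA p (hPA x hx p hp).1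
  have hZ : ∀ C ⊆ S, ∀ i ∈ C, ∀ j ∈ C, i ≠ j → ∀ a ∈ A, ∀ p ∈ P i, ∀ q ∈ P j,
      (a * p + q, i * (a * p) + j * q) ∈ {w ∈ T ×ˢ T | (∃ c ∈ C, c < w.2 / w.1) ∧
        ∃ c ∈ C, w.2 / w.1 < c} := by
    intro C hC i hi j hj hij a ha p hp q hq
    obtain ⟨hpA, hip⟩ := hPA i (hC hi) p hp
    obtain ⟨hqA, hjq⟩ := hPA j (hC hj) q hq
    refine mem_filter.2 ⟨mem_product.2 ⟨hmem a ha p hpA q hqA, ?_⟩,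
      slope_between hi hj hij (mul_pos (hA a ha) (hA p hpA)) (hA q hqA)⟩
    have := hmem a ha (i * p) hip (j * q) hjq
    rwa [mul_left_comm] at this
  have hgoal : (#A : ℝ) ^ 3 * K / (8 * L) ≤ #(T ×ˢ T) := by
    have hsplit := card_filter_add_card_filter_not (s := S) (fun x => K * #A < (#(A * P x) : ℝ))
    set S₁ := {x ∈ S | K * #A < (#(A * P x) : ℝ)} with hS₁
    set S₀ := {x ∈ S | ¬ K * #A < (#(A * P x) : ℝ)} with hS₀
    have hτn2 : (τ : ℝ) * (16 * K ^ 2) ≤ #A ^ 2 := by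
      rw [sq (#A : ℝ)]; gcongr
    rcases le_total #S₀ #S₁ with hle | hle
    · have hS2 : (#S : ℝ) ≤ 2 * #S₁ := by exact_mod_cast (by omega : #S ≤ 2 * #S₁)
      refine card_ge_of_rich_clusters (fun w => w.2 / w.1) S₁ (T ×ˢ T) (m := 2) (τ := τ)
        two_pos hτ hL0 hn0.le hK0.le ?_ ?_ ?_
      · calc (#A : ℝ) ^ 2 ≤ L * τ * #S := hSn
          _ ≤ L * τ * (2 * #S₁) := by gcongr
          _ = _ := by ring
      · refine le_trans ?_ hτn2
        push_cast
        have : 4 * L ≤ 16 * K ^ 2 := by nlinarith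
        nlinarith
      · intro C hC hC2
        obtain ⟨i, j, hij, rfl⟩ := card_eq_two.1 hC2
        have hCS : {i, j} ⊆ S := hC.trans (filter_subset _ _)
        have hi : i ∈ ({i, j} : Finset ℝ) := by simp
        have hj : j ∈ ({i, j} : Finset ℝ) := by simp
        have hcard := card_mul_card_le_of_two_lines (A * P i) (P j) _ hij (fun u hu q hq => by
          obtain ⟨a, ha, p, hp, rfl⟩ := mem_mul.1 hu
          exact hZ _ hCS i hi j hj hij a ha p hp q hq)
        rw [hPτ j (hCS hj)] at hcard
        have hbig := (mem_filter.1 (hC hi)).2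
        calc K * #A * τ * ((2 : ℕ) / 2) = K * #A * τ := by norm_num
          _ ≤ #(A * P i) * τ := by gcongr
          _ ≤ _ := by exact_mod_cast hcard
    · have hS2 : (#S : ℝ) ≤ 2 * #S₀ := by exact_mod_cast (by omega : #S ≤ 2 * #S₀)
      have hSn2 : (#A : ℝ) ^ 2 ≤ 2 * L * τ * #S₀ := by
        calc (#A : ℝ) ^ 2 ≤ L * τ * #S := hSn
          _ ≤ L * τ * (2 * #S₀) := by gcongr
          _ = _ := by ring
      have hS₀S : S₀ ⊆ S := filter_subset _ _
      have hhalf : ∀ M : ℕ, K * #A * τ * ((2 * M : ℕ) / 2) = K * M * #A * τ := fun M => by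
        push_cast; ring
      rcases lt_or_ge (16 * K ^ 2 * τ ^ 2 : ℝ) #A with hsmall | hlarge
      · have hM1 : 3 * K * τ ≤ (⌈3 * K * τ⌉₊ : ℝ) := Nat.le_ceil _
        have hM2 : (⌈3 * K * τ⌉₊ : ℝ) ≤ 4 * K * τ := by
          have := Nat.ceil_lt_add_one (a := 3 * K * τ) (by positivity)
          nlinarith
        have hM0 : 0 < ⌈3 * K * τ⌉₊ := Nat.ceil_pos.2 (by positivity)
        set M := ⌈3 * K * τ⌉₊
        refine card_ge_of_rich_clusters (fun w => w.2 / w.1) S₀ (T ×ˢ T) (m := 2 * M) (τ := τ)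
          (by omega) hτ hL0 hn0.le hK0.le hSn2 ?_ ?_
        · calc 2 * L * τ * (2 * M : ℕ) = 4 * (L * τ * M) := by push_cast; ring
            _ ≤ 4 * (K * τ * (4 * K * τ)) := by gcongr
            _ = 16 * K ^ 2 * τ ^ 2 := by ring
            _ ≤ #A := hsmall.le
            _ ≤ #A ^ 2 := le_self_pow₀ (by nlinarith) (by norm_num)
        · intro C hC hC2
          rw [hhalf]
          refine cluster_card_le_of_small_richness A C P _ hne hτ hM0 hK0 hC2
            (fun x hx => hP0 x (hS₀S (hC hx))) (fun x hx => hPτ x (hS₀S (hC hx)))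
            (hZ C (hC.trans hS₀S)) hM1 ?_
          calc 3 * K * M * τ ≤ 3 * K * (4 * K * τ) * τ := by gcongr
            _ = 12 * K ^ 2 * τ ^ 2 := by ring
            _ ≤ 16 * K ^ 2 * τ ^ 2 := by gcongr; norm_num
            _ ≤ #A := hsmall.le
      · have hM1 : 3 * K ≤ (⌈3 * K⌉₊ : ℝ) := Nat.le_ceil _
        have hM2 : (⌈3 * K⌉₊ : ℝ) ≤ 4 * K := by
          have := Nat.ceil_lt_add_one (a := 3 * K) (by positivity)
          nlinarith
        have hM0 : 0 < ⌈3 * K⌉₊ := Nat.ceil_pos.2 (by positivity)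
        set M := ⌈3 * K⌉₊
        refine card_ge_of_rich_clusters (fun w => w.2 / w.1) S₀ (T ×ˢ T) (m := 2 * M) (τ := τ)
          (by omega) hτ hL0 hn0.le hK0.le hSn2 ?_ ?_
        · calc 2 * L * τ * (2 * M : ℕ) = 4 * (L * τ * M) := by push_cast; ring
            _ ≤ 4 * (K * τ * (4 * K)) := by gcongr
            _ = τ * (16 * K ^ 2) := by ring
            _ ≤ #A ^ 2 := hτn2
        · intro C hC hC2
          rw [hhalf]
          exact cluster_card_le_of_large_richness A C P _ hne hτ hτA hM0 hK hAK hlarge hC2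
            (fun x hx => hP0 x (hS₀S (hC hx))) (fun x hx => hPτ x (hS₀S (hC hx)))
            (fun x hx => not_lt.1 (mem_filter.1 (hC hx)).2)
            (hZ C (hC.trans hS₀S)) hM1 hM2
  rw [card_product] at hgoal
  push_cast at hgoal
  rwa [← sq] at hgoal

lemma eventually_log_le_rpow : ∀ᶠ n : ℕ in Filter.atTop,
    1000 ≤ (n : ℝ) ^ ((1 : ℝ) / 100) ∧ 8 * (1 + Real.log n) ≤ (n : ℝ) ^ ((1 : ℝ) / 200) := by
  have h1 : ∀ᶠ x : ℝ in Filter.atTop, 1000 ≤ x ^ ((1 : ℝ) / 100) :=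
    (tendsto_rpow_atTop (by norm_num)).eventually_ge_atTop _
  have h2 : ∀ᶠ x : ℝ in Filter.atTop, 16 ≤ x ^ ((1 : ℝ) / 200) :=
    (tendsto_rpow_atTop (by norm_num)).eventually_ge_atTop _
  have h3 := (isLittleO_log_rpow_atTop (r := 1 / 200) (by norm_num)).bound
    (show (0 : ℝ) < 1 / 16 by norm_num)
  refine tendsto_natCast_atTop_atTop.eventually (p := fun x : ℝ => 1000 ≤ x ^ ((1 : ℝ) / 100) ∧
    8 * (1 + Real.log x) ≤ x ^ ((1 : ℝ) / 200)) ?_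
  filter_upwards [h1, h2, h3] with x hx1 hx2 hx3
  refine ⟨hx1, ?_⟩
  rw [Real.norm_eq_abs, Real.norm_eq_abs, abs_of_pos (a := x ^ _) (by linarith)] at hx3
  linarith [le_abs_self (Real.log x)]

end

/-- There exist a real constant `c > 0`, a constant `C > 0` and a positive integer `n₀`
such that for every finite set `A` of positive real numbers with `|A| ≥ n₀` one has
`|AA+A| ≥ C·|A|^(3/2 + c)`. -/
theorem exists_lower_bound_AA_add_A :
    ∃ c : ℝ, 0 < c ∧ ∃ C : ℝ, 0 < C ∧ ∃ n₀ : ℕ, 0 < n₀ ∧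
      ∀ A : Finset ℝ, (∀ a ∈ A, 0 < a) → n₀ ≤ A.card →
        C * (A.card : ℝ) ^ ((3 : ℝ) / 2 + c) ≤
          (((A ×ˢ A ×ˢ A).image
            (fun p : ℝ × ℝ × ℝ => p.1 * p.2.1 + p.2.2)).card : ℝ) := by
  obtain ⟨n₀, hn₀⟩ := Filter.eventually_atTop.1 eventually_log_le_rpow
  refine ⟨1 / 400, by norm_num, 1, one_pos, n₀ + 1, Nat.succ_pos _, fun A hA hcard => ?_⟩
  obtain ⟨hK, hL⟩ := hn₀ A.card (by omega)
  have hn : (0 : ℝ) < A.card := by exact_mod_cast (by omega : 0 < A.card)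
  have hn1 : (1 : ℝ) ≤ A.card := by exact_mod_cast (by omega : 1 ≤ A.card)
  have hlog : 0 ≤ Real.log A.card := Real.log_nonneg hn1
  have hAK : (A.card : ℝ) = ((A.card : ℝ) ^ ((1 : ℝ) / 100)) ^ 100 := by
    rw [← Real.rpow_mul_natCast hn.le, show (1 : ℝ) / 100 * (100 : ℕ) = 1 by norm_num,
      Real.rpow_one]
  have hmono : (A.card : ℝ) ^ ((1 : ℝ) / 200) ≤ (A.card : ℝ) ^ ((1 : ℝ) / 100) :=
    Real.rpow_le_rpow_of_exponent_le hn1 (by norm_num)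
  have hmain := card_AA_add_A_sq_ge A hA hK hAK le_rfl (by linarith)
  rw [one_mul]
  refine le_of_sq_le_sq (le_trans ?_ hmain) (Nat.cast_nonneg _)
  rw [le_div_iff₀ (by positivity)]
  have hsplit : (A.card : ℝ) ^ ((1 : ℝ) / 100) =
      (A.card : ℝ) ^ ((1 : ℝ) / 200) * (A.card : ℝ) ^ ((1 : ℝ) / 200) := by
    rw [← Real.rpow_add hn]; norm_num
  have hsq : ((A.card : ℝ) ^ ((3 : ℝ) / 2 + 1 / 400)) ^ 2 =
      (A.card : ℝ) ^ 3 * (A.card : ℝ) ^ ((1 : ℝ) / 200) := by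
    rw [← Real.rpow_natCast, ← Real.rpow_mul hn.le, ← Real.rpow_natCast _ 3, ← Real.rpow_add hn]
    norm_num
  rw [hsq, hsplit, ← mul_assoc ((A.card : ℝ) ^ 3)]
  exact mul_le_mul_of_nonneg_left hL
    (mul_nonneg (pow_nonneg hn.le 3) (Real.rpow_nonneg hn.le _))
end

section
/- There exist a real constant c > 0, a constant C > 0 and a positive integer n₀ such that for all finite sets A and B of positive real numbers with |A| = |B| ≥ n₀ one has |AB+A| ≥ C·|A|^(3/2 + c). -/
open Finset

/-- The number of elements of `Y` that are smaller than `y`. -/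
noncomputable def rankIn (Y : Finset ℝ) (y : ℝ) : ℕ := #{z ∈ Y | z < y}

/-- Ordered pairs of elements of `Y` lying in the same block, when the elements of `Y` are listed
in increasing order and cut into blocks of length `T`. -/
noncomputable def nearPairs (Y : Finset ℝ) (T : ℕ) : Finset (ℝ × ℝ) :=
  (Y ×ˢ Y).filter fun p => rankIn Y p.1 / T = rankIn Y p.2 / T

/-- Triples `(a, c, x)` such that the line with slope `a` and intercept `c` maps `x` into `Y`. -/
noncomputable def hits (A C X Y : Finset ℝ) : Finset (ℝ × ℝ × ℝ) :=
  (A ×ˢ C ×ˢ X).filter fun p => p.2.1 + p.1 * p.2.2 ∈ Y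

/-- Lines together with two distinct near points whose images are near points of `Y`. -/
noncomputable def nearHits (A C X Y : Finset ℝ) (Tx Ty : ℕ) : Finset (ℝ × ℝ × ℝ × ℝ) :=
  (A ×ˢ C ×ˢ nearPairs X Tx).filter fun q => q.2.2.1 ≠ q.2.2.2 ∧
    (q.2.1 + q.1 * q.2.2.1, q.2.1 + q.1 * q.2.2.2) ∈ nearPairs Y Ty


lemma rankIn_mono (Y : Finset ℝ) : Monotone (rankIn Y) := fun _ _ h =>
  card_le_card (monotone_filter_right _ fun _ _ hz => lt_of_lt_of_le hz h)

lemma rankIn_lt_of_lt {Y : Finset ℝ} {y z : ℝ} (hy : y ∈ Y) (h : y < z) :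
    rankIn Y y < rankIn Y z := by
  apply card_lt_card
  refine ⟨monotone_filter_right _ fun _ _ hz => lt_trans hz h, fun hs => ?_⟩
  have := hs (mem_filter.2 ⟨hy, h⟩)
  simp at this

lemma rankIn_lt_card {Y : Finset ℝ} {y : ℝ} (hy : y ∈ Y) : rankIn Y y < #Y := by
  apply card_lt_card
  refine ⟨filter_subset _ _, fun hs => ?_⟩
  have := hs hy
  simp at this

lemma rankIn_injOn (Y : Finset ℝ) : Set.InjOn (rankIn Y) Y := by
  intro y hy z hz h
  rcases lt_trichotomy y z with h1 | h1 | h1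
  · exact absurd h (rankIn_lt_of_lt hy h1).ne
  · exact h1
  · exact absurd h (rankIn_lt_of_lt hz h1).ne'

lemma card_nearPairs_le (Y : Finset ℝ) {T : ℕ} (hT : 0 < T) : #(nearPairs Y T) ≤ #Y * T := by
  have : #(Y ×ˢ range T) = #Y * T := by simp
  rw [← this]
  apply card_le_card_of_injOn (fun p => (p.1, rankIn Y p.2 % T))
  · intro p hp
    simp only [nearPairs, coe_filter, mem_product, Set.mem_ofPred_eq] at hp
    simp [hp.1.1, Nat.mod_lt _ hT]
  · intro p hp q hq h
    simp only [nearPairs, coe_filter, mem_product, Set.mem_ofPred_eq] at hp hq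
    simp only [Prod.mk.injEq] at h
    refine Prod.ext h.1 (rankIn_injOn Y hp.1.2 hq.1.2 ?_)
    have e : rankIn Y p.2 / T = rankIn Y q.2 / T := by rw [← hp.2, ← hq.2, h.1]
    rw [← Nat.div_add_mod (rankIn Y p.2) T, ← Nat.div_add_mod (rankIn Y q.2) T, e, h.2]

lemma sq_card_le_card_mul_collisions {α β : Type*} [DecidableEq β] (s : Finset α) (t : Finset β)
    (f : α → β) (hf : ∀ a ∈ s, f a ∈ t) :
    #s ^ 2 ≤ #t * #{p ∈ s ×ˢ s | f p.1 = f p.2} := by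
  have h1 : #s = ∑ b ∈ t, #{a ∈ s | f a = b} := card_eq_sum_card_fiberwise hf
  have h2 : #{p ∈ s ×ˢ s | f p.1 = f p.2} = ∑ b ∈ t, #{a ∈ s | f a = b} ^ 2 := by
    rw [card_eq_sum_card_fiberwise (f := fun p => f p.1) (t := t)]
    · refine sum_congr rfl fun b _ => ?_
      rw [sq, ← card_product]
      congr 1
      ext ⟨x, y⟩
      simp only [mem_filter, mem_product]
      grind
    · intro p hp
      simp only [coe_filter, mem_product, Set.mem_ofPred_eq] at hp
      exact hf _ hp.1.1
  rw [h2]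
  conv_lhs => rw [h1]
  exact sq_sum_le_card_mul_sum_sq

lemma sq_card_hits_le {A C X Y : Finset ℝ} (hA : ∀ a ∈ A, 0 < a) (Tx Ty : ℕ) :
    #(hits A C X Y) ^ 2 ≤ #A * (#C * (#X / Tx + #Y / Ty + 1)) *
      (#(nearHits A C X Y Tx Ty) + #(hits A C X Y)) := by
  set E := hits A C X Y with hE
  have memE : ∀ p, p ∈ E ↔ (p.1 ∈ A ∧ p.2.1 ∈ C ∧ p.2.2 ∈ X) ∧ p.2.1 + p.1 * p.2.2 ∈ Y := by
    intro p; simp [hE, hits]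
  set f : ℝ × ℝ × ℝ → ℝ × ℝ × ℕ := fun p =>
    (p.1, p.2.1, rankIn X p.2.2 / Tx + rankIn Y (p.2.1 + p.1 * p.2.2) / Ty) with hf
  have h := sq_card_le_card_mul_collisions E (A ×ˢ C ×ˢ range (#X / Tx + #Y / Ty + 1)) f (by
    intro p hp
    obtain ⟨⟨h1, h2, h3⟩, h4⟩ := (memE p).1 hp
    simp only [hf, mem_product, h1, h2, mem_range, true_and]
    have := Nat.div_le_div_right (c := Tx) (rankIn_lt_card h3).le
    have := Nat.div_le_div_right (c := Ty) (rankIn_lt_card h4).le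
    omega)
  rw [card_product, card_product, card_range] at h
  refine h.trans (Nat.mul_le_mul_left _ ?_)
  rw [← card_filter_add_card_filter_not (fun p : (ℝ × ℝ × ℝ) × (ℝ × ℝ × ℝ) => p.1 ≠ p.2)]
  apply add_le_add
  · apply card_le_card_of_injOn (fun p => (p.1.1, p.1.2.1, p.1.2.2, p.2.2.2))
    · rintro ⟨⟨a, c, x⟩, ⟨a', c', x'⟩⟩ hp
      simp only [coe_filter, mem_filter, mem_product, memE, hf, Prod.mk.injEq, ne_eq,
        Set.mem_ofPred_eq] at hp
      obtain ⟨⟨⟨⟨⟨h1, h2, h3⟩, h4⟩, ⟨⟨-, -, h5⟩, h6⟩⟩, rfl, rfl, h7⟩, h8⟩ := hp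
      have hne : x ≠ x' := by simpa using h8
      have key : rankIn X x / Tx = rankIn X x' / Tx ∧
          rankIn Y (c + a * x) / Ty = rankIn Y (c + a * x') / Ty := by
        have ha := hA a h1
        rcases le_total x x' with hx | hx
        · have := Nat.div_le_div_right (c := Tx) (rankIn_mono X hx)
          have := Nat.div_le_div_right (c := Ty)
            (rankIn_mono Y (show c + a * x ≤ c + a * x' by gcongr))
          omega
        · have := Nat.div_le_div_right (c := Tx) (rankIn_mono X hx)
          have := Nat.div_le_div_right (c := Ty)
            (rankIn_mono Y (show c + a * x' ≤ c + a * x by gcongr))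
          omega
      simp [nearHits, nearPairs, h1, h2, h3, h4, h5, h6, hne, key.1, key.2]
    · rintro ⟨⟨a, c, x⟩, ⟨a', c', x'⟩⟩ hp ⟨⟨b, d, y⟩, ⟨b', d', y'⟩⟩ hq he
      simp only [coe_filter, mem_filter, mem_product, hf, Prod.mk.injEq,
        Set.mem_ofPred_eq] at hp hq he
      grind
  · apply card_le_card_of_injOn (fun p => p.1)
    · intro p hp
      simp only [coe_filter, mem_filter, mem_product, Set.mem_ofPred_eq] at hp
      exact hp.1.1.1
    · intro p hp q hq he
      simp only [coe_filter, mem_filter, ne_eq, not_not, Set.mem_ofPred_eq] at hp hq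
      exact Prod.ext he (by rw [← hp.2, ← hq.2]; exact he)

lemma card_nearHits_le (A C X Y : Finset ℝ) (Tx Ty : ℕ) :
    #(nearHits A C X Y Tx Ty) ≤ #(nearPairs X Tx) * #(nearPairs Y Ty) := by
  rw [← card_product]
  apply card_le_card_of_injOn
    (fun q => (q.2.2, (q.2.1 + q.1 * q.2.2.1, q.2.1 + q.1 * q.2.2.2)))
  · intro q hq
    simp only [nearHits, coe_filter, mem_product, Set.mem_ofPred_eq] at hq
    simp only [coe_product, Set.mem_prod, mem_coe]
    exact ⟨hq.1.2.2, hq.2.2⟩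
  · rintro ⟨a, c, x, x'⟩ hp ⟨b, d, y, y'⟩ hq he
    simp only [nearHits, coe_filter, mem_product, Set.mem_ofPred_eq] at hp hq
    simp only [Prod.mk.injEq] at he
    obtain ⟨⟨rfl, rfl⟩, h1, h2⟩ := he
    have hne : x - x' ≠ 0 := sub_ne_zero.2 hp.2.1
    have hab : a = b := by
      apply mul_right_cancel₀ hne
      linear_combination h1 - h2
    subst hab
    have : c = d := by linear_combination h1
    simp [this]

lemma card_hits_le {A C X Y : Finset ℝ} (hA : ∀ a ∈ A, 0 < a) {N : ℕ} (hAN : #A = N)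
    (hCN : #C = N) (hYN : #Y = N) : #(hits A C X Y) ^ 3 ≤ 512 * #X ^ 2 * N ^ 6 := by
  set E := #(hits A C X Y) with hE
  set K := #X with hK
  have hEK : E ≤ N * (N * K) := by
    rw [← hAN]; nth_rw 2 [hAN]; rw [← hCN, hK, ← card_product, ← card_product]
    exact card_filter_le _ _
  have hEN : E ≤ N * (N * N) := by
    have : #(A ×ˢ C ×ˢ Y) = N * (N * N) := by simp [hAN, hCN, hYN]
    rw [← this]
    apply card_le_card_of_injOn (fun p => (p.1, p.2.1, p.2.1 + p.1 * p.2.2))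
    · intro p hp
      simp only [hits, coe_filter, mem_product, Set.mem_ofPred_eq] at hp
      simp [hp.1.1, hp.1.2.1, hp.2]
    · rintro ⟨a, c, x⟩ hp ⟨a', c', x'⟩ hq he
      simp only [hits, coe_filter, mem_product, Set.mem_ofPred_eq] at hp
      simp only [Prod.mk.injEq] at he
      obtain ⟨rfl, rfl, h⟩ := he
      have := (hA a hp.1.1).ne'
      simpa [this] using h
  rcases Nat.eq_zero_or_pos K with hK0 | hKpos
  · have : E = 0 := by simpa [hK0] using hEK
    simp [this]
  rcases Nat.eq_zero_or_pos N with hN0 | hNpos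
  · have : E = 0 := by simpa [hN0] using hEK
    simp [this]
  rcases le_or_gt E (8 * N ^ 2) with hsmall | hbig
  · calc E ^ 3 ≤ (8 * N ^ 2) ^ 3 := Nat.pow_le_pow_left hsmall 3
      _ = 512 * 1 * N ^ 6 := by ring
      _ ≤ 512 * K ^ 2 * N ^ 6 := by gcongr; exact Nat.one_le_pow _ _ hKpos
  clear_value E K
  obtain ⟨e, he⟩ : ∃ e : ℝ, e = (E : ℝ) / (N : ℝ) ^ 2 := ⟨_, rfl⟩
  have hN' : (0 : ℝ) < N := by exact_mod_cast hNpos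
  have hK' : (0 : ℝ) < K := by exact_mod_cast hKpos
  have hEe : (E : ℝ) = e * N ^ 2 := by rw [he]; field_simp
  have he8 : 8 ≤ e := by
    rw [he, le_div_iff₀ (by positivity)]; exact_mod_cast hbig.le
  have heK : e ≤ K := by
    rw [he, div_le_iff₀ (by positivity)]
    have : (E : ℝ) ≤ N * (N * K) := by exact_mod_cast hEK
    linarith
  have heN : e ≤ N := by
    rw [he, div_le_iff₀ (by positivity)]
    have : (E : ℝ) ≤ N * (N * N) := by exact_mod_cast hEN
    linarith
  have block : ∀ Z : ℕ, e ≤ Z → ∃ T : ℕ, 0 < T ∧ (T : ℝ) ≤ 16 * Z / e ∧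
      ((Z / T : ℕ) : ℝ) ≤ e / 8 := by
    intro Z hZ
    have hZ0 : (0 : ℝ) < Z := by linarith
    have h1 : 1 ≤ 8 * Z / e := by rw [le_div_iff₀ (by linarith)]; linarith
    refine ⟨⌈8 * Z / e⌉₊, Nat.ceil_pos.2 (by linarith), ?_, ?_⟩
    · have := (Nat.ceil_lt_add_one (show 0 ≤ 8 * Z / e by linarith)).le
      have h2 : 16 * Z / e = 8 * Z / e + 8 * Z / e := by ring
      linarith
    · refine Nat.cast_div_le.trans ?_
      have := Nat.le_ceil (8 * Z / e)
      calc (Z : ℝ) / (⌈8 * Z / e⌉₊ : ℝ) ≤ Z / (8 * Z / e) := by gcongr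
        _ = e / 8 := by field_simp
  obtain ⟨Tx, hTx, hTx1, hTx2⟩ := block K heK
  obtain ⟨Ty, hTy, hTy1, hTy2⟩ := block N heN
  have h1 := sq_card_hits_le (C := C) (X := X) (Y := Y) hA Tx Ty
  rw [hAN, hCN, hYN, ← hE, ← hK] at h1
  have h2 : #(nearHits A C X Y Tx Ty) ≤ (K * Tx) * (N * Ty) := by
    refine (card_nearHits_le A C X Y Tx Ty).trans ?_
    have h3 := card_nearPairs_le X hTx
    have h4 := card_nearPairs_le Y hTy
    rw [← hK] at h3
    rw [hYN] at h4
    gcongr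
  have h1' : (E : ℝ) ^ 2 ≤ N * (N * ((K / Tx : ℕ) + (N / Ty : ℕ) + 1)) *
      (#(nearHits A C X Y Tx Ty) + E) := by exact_mod_cast h1
  have h2' : (#(nearHits A C X Y Tx Ty) : ℝ) ≤ (K * Tx) * (N * Ty) := by exact_mod_cast h2
  obtain ⟨P, hP⟩ : ∃ P : ℝ, P = (#(nearHits A C X Y Tx Ty) : ℝ) := ⟨_, rfl⟩
  rw [← hP] at h1' h2'
  have hP0 : 0 ≤ P := by rw [hP]; exact Nat.cast_nonneg _
  have hPE : (E : ℝ) ≤ P := by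
    have h5 : (E : ℝ) ^ 2 ≤ N * (N * (e / 2)) * (P + E) := by
      refine h1'.trans ?_
      gcongr
      linarith
    rw [hEe] at h5 ⊢
    have h6 : e * N ^ 2 * (2 * (e * N ^ 2)) ≤ e * N ^ 2 * (P + e * N ^ 2) := by nlinarith
    have := le_of_mul_le_mul_left h6 (by positivity)
    linarith
  have h7 : (E : ℝ) ≤ (K * (16 * K / e)) * (N * (16 * N / e)) := by
    refine (hPE.trans h2').trans ?_
    gcongr
  have h8 : (E : ℝ) ^ 3 ≤ 256 * K ^ 2 * N ^ 6 := by
    have h9 : (K * (16 * K / e)) * (N * (16 * N / e)) = 256 * K ^ 2 * N ^ 2 / e ^ 2 := by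
      field_simp; ring
    rw [h9, le_div_iff₀ (by positivity)] at h7
    calc (E : ℝ) ^ 3 = (E * e ^ 2) * N ^ 4 := by rw [hEe]; ring
      _ ≤ (256 * (K : ℝ) ^ 2 * (N : ℝ) ^ 2) * (N : ℝ) ^ 4 := by gcongr
      _ = _ := by ring
  have h10 : E ^ 3 ≤ 256 * K ^ 2 * N ^ 6 := by exact_mod_cast h8
  refine h10.trans ?_
  gcongr
  norm_num


lemma sum_le_card_popular_mul_add {α : Type*} (I : Finset α) (f : α → ℝ) {t M : ℝ} (ht : 0 ≤ t)
    (hM : ∀ i ∈ I, f i ≤ M) :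
    ∑ i ∈ I, f i ≤ #{i ∈ I | t ≤ f i} * M + #I * t := by
  rw [← sum_filter_add_sum_filter_not I (fun i => t ≤ f i)]
  apply add_le_add
  · rw [← nsmul_eq_mul]
    exact sum_le_card_nsmul _ _ _ fun i hi => hM i (mem_filter.1 hi).1
  · calc ∑ i ∈ I with ¬ t ≤ f i, f i ≤ #{i ∈ I | ¬ t ≤ f i} • t :=
        sum_le_card_nsmul _ _ _ fun i hi => (not_le.1 (mem_filter.1 hi).2).le
      _ ≤ #I * t := by
        rw [nsmul_eq_mul]
        gcongr
        exact filter_subset _ _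

lemma card_hits_eq_of_forall {A C X Y : Finset ℝ}
    (h : ∀ a ∈ A, ∀ c ∈ C, ∀ x ∈ X, c + a * x ∈ Y) : #(hits A C X Y) = #A * (#C * #X) := by
  rw [← card_product, ← card_product, hits, filter_true_of_mem]
  rintro ⟨a, c, x⟩ hp
  simp only [mem_product] at hp
  exact h a hp.1 c hp.2.1 x hp.2.2

/-- The ratio of the lengths of the intervals with end points `i` and `j`. -/
noncomputable def pairRatio (i j : ℝ × ℝ) : ℝ := (i.2 - i.1) / (j.2 - j.1)

/-- The translation part of the affine map sending the interval `j` to the interval `i`. -/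
noncomputable def pairShift (i j : ℝ × ℝ) : ℝ := i.1 - j.1 * pairRatio i j

/-- Pairs `(a, c)` of elements of `A` that stay in `A × A` under `(a, c) ↦ (a ρ, c + a σ)`. -/
noncomputable def shearPairs (A : Finset ℝ) (ρ σ : ℝ) : Finset (ℝ × ℝ) :=
  (A ×ˢ A).filter fun p => p.1 * ρ ∈ A ∧ p.2 + p.1 * σ ∈ A

lemma card_nearHits_lower {A B S : Finset ℝ} {N Ty : ℕ} (hA : ∀ a ∈ A, 0 < a) (hAN : #A = N)
    (hBN : #B = N) (hN : 4 ≤ N) (hS : ∀ a ∈ A, ∀ c ∈ A, ∀ b ∈ B, c + a * b ∈ S)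
    (hT : 8 * (#S : ℝ) / N ≤ Ty) (hSpos : 0 < #S) : N ^ 3 ≤ #(nearHits A A B S 8 Ty) := by
  have h := sq_card_hits_le (C := A) (X := B) (Y := S) hA 8 Ty
  rw [card_hits_eq_of_forall hS, hAN, hBN] at h
  generalize #(nearHits A A B S 8 Ty) = P at h ⊢
  generalize #S = s at h hT hSpos
  have hN' : (4 : ℝ) ≤ N := by exact_mod_cast hN
  have hs' : (0 : ℝ) < s := by exact_mod_cast hSpos
  have h1 : ((N / 8 : ℕ) : ℝ) ≤ N / 8 := by exact_mod_cast Nat.cast_div_le (m := N) (n := 8)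
  have h2 : ((s / Ty : ℕ) : ℝ) ≤ N / 8 := by
    refine Nat.cast_div_le.trans ?_
    calc (s : ℝ) / Ty ≤ s / (8 * s / N) := by gcongr
      _ = N / 8 := by field_simp
  have h3 : ((N : ℝ) * (N * N)) ^ 2 ≤ N * (N * ((N / 8 : ℕ) + (s / Ty : ℕ) + 1)) *
      (P + N * (N * N)) := by exact_mod_cast h
  have h4 : ((N : ℝ) * (N * N)) ^ 2 ≤ N * (N * (N / 2)) * (P + N * (N * N)) := by
    refine h3.trans ?_
    gcongr
    linarith
  have h5 : (N : ℝ) ^ 3 * (2 * N ^ 3) ≤ N ^ 3 * (P + N ^ 3) := by nlinarith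
  have h6 := le_of_mul_le_mul_left h5 (by positivity)
  have h7 : (N : ℝ) ^ 3 ≤ P := by linarith
  exact_mod_cast h7

lemma collisions_le_sum_shearPairs (A B S : Finset ℝ) (Tx Ty : ℕ) :
    #{p ∈ nearHits A A B S Tx Ty ×ˢ nearHits A A B S Tx Ty |
      (p.1.2.1 + p.1.1 * p.1.2.2.1, p.1.2.1 + p.1.1 * p.1.2.2.2) =
      (p.2.2.1 + p.2.1 * p.2.2.2.1, p.2.2.1 + p.2.1 * p.2.2.2.2)} ≤
    ∑ j ∈ nearPairs B Tx with j.1 ≠ j.2, ∑ i ∈ nearPairs B Tx with i.1 ≠ i.2,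
      #(shearPairs A (pairRatio i j) (pairShift i j)) := by
  set D := {j ∈ nearPairs B Tx | j.1 ≠ j.2} with hD
  rw [← sum_product', ← card_sigma (D ×ˢ D)
    (fun p => shearPairs A (pairRatio p.2 p.1) (pairShift p.2 p.1))]
  apply card_le_card_of_injOn
    (fun p => ⟨(p.2.2.2, p.1.2.2), (p.1.1, p.1.2.1)⟩)
  · rintro ⟨⟨a, c, x, x'⟩, ⟨b, d, y, y'⟩⟩ hp
    simp only [nearHits, coe_filter, mem_filter, mem_product, Prod.mk.injEq,
      Set.mem_ofPred_eq] at hp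
    obtain ⟨⟨⟨⟨ha, hc, hx⟩, hne, -⟩, ⟨⟨hb, hd, hy⟩, hne', -⟩⟩, h1, h2⟩ := hp
    have h0 : y' - y ≠ 0 := sub_ne_zero.2 (Ne.symm hne')
    have e1 : a * pairRatio (x, x') (y, y') = b := by
      simp only [pairRatio]
      field_simp
      linear_combination h2 - h1
    have e2 : c + a * pairShift (x, x') (y, y') = d := by
      simp only [pairShift]
      linear_combination h1 - y * e1
    simp only [coe_sigma, Set.mem_sigma_iff, coe_product, Set.mem_prod, mem_coe, hD, mem_filter,
      shearPairs, mem_product]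
    exact ⟨⟨⟨hy, hne'⟩, ⟨hx, hne⟩⟩, ⟨ha, hc⟩, by rw [e1]; exact hb, by rw [e2]; exact hd⟩
  · rintro ⟨⟨a, c, x, x'⟩, ⟨b, d, y, y'⟩⟩ hp ⟨⟨a1, c1, x1, x1'⟩, ⟨b1, d1, y1, y1'⟩⟩ hq he
    simp only [nearHits, coe_filter, mem_filter, mem_product, Prod.mk.injEq,
      Set.mem_ofPred_eq] at hp hq
    simp only [Sigma.mk.injEq, Prod.mk.injEq, heq_eq_eq] at he
    obtain ⟨⟨⟨rfl, rfl⟩, rfl, rfl⟩, rfl, rfl⟩ := he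
    obtain ⟨⟨-, ⟨-, hne', -⟩⟩, h1, h2⟩ := hp
    obtain ⟨-, h3, h4⟩ := hq
    have hb : b = b1 := by
      apply mul_right_cancel₀ (sub_ne_zero.2 hne')
      linear_combination h3 - h1 - (h4 - h2)
    subst hb
    have : d = d1 := by linear_combination h3 - h1
    simp [this]

lemma exists_pair_many_shearPairs {A B S : Finset ℝ} {N : ℕ} {θ : ℝ} (hA : ∀ a ∈ A, 0 < a)
    (hAN : #A = N) (hBN : #B = N) (hN : 4 ≤ N)
    (hS : ∀ a ∈ A, ∀ c ∈ A, ∀ b ∈ B, c + a * b ∈ S)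
    (hθ : 0 < θ) (hSθ : 648 * θ * (#S : ℝ) ^ 2 ≤ (N : ℝ) ^ 3) :
    ∃ (D : Finset (ℝ × ℝ)) (j : ℝ × ℝ), j.1 ≠ j.2 ∧
      θ * N ≤ #{i ∈ D | θ * N ^ 2 ≤ #(shearPairs A (pairRatio i j) (pairShift i j))} := by
  have hN' : (4 : ℝ) ≤ N := by exact_mod_cast hN
  have hNS : N ≤ #S := by
    obtain ⟨b, hb⟩ : B.Nonempty := card_pos.1 (by omega)
    obtain ⟨a, ha⟩ : A.Nonempty := card_pos.1 (by omega)
    rw [← hAN]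
    exact card_le_card_of_injOn (fun c => c + a * b) (fun c hc => hS a ha c hc b hb)
      (fun x _ y _ h => by simpa using h)
  have hNS' : (N : ℝ) ≤ #S := by exact_mod_cast hNS
  have hspos : 0 < #S := by omega
  set Ty := ⌈8 * (#S : ℝ) / N⌉₊ with hTy
  have hTy0 : 0 < Ty := Nat.ceil_pos.2 (div_pos (by linarith) (by linarith))
  have hTy1 : (Ty : ℝ) ≤ 9 * #S / N := by
    have := (Nat.ceil_lt_add_one (show 0 ≤ 8 * (#S : ℝ) / N from
      div_nonneg (by linarith) (by linarith))).le
    have h1 : 1 ≤ (#S : ℝ) / N := by rw [le_div_iff₀ (by linarith)]; linarith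
    have h2 : 9 * (#S : ℝ) / N = 8 * #S / N + #S / N := by ring
    linarith
  have hP := card_nearHits_lower hA hAN hBN hN hS (Nat.le_ceil _) hspos
  have hcoll := sq_card_le_card_mul_collisions (nearHits A A B S 8 Ty) (nearPairs S Ty)
    (fun q => (q.2.1 + q.1 * q.2.2.1, q.2.1 + q.1 * q.2.2.2)) (fun q hq => by
      simp only [nearHits, mem_filter] at hq
      exact hq.2.2)
  have hsum := collisions_le_sum_shearPairs A B S 8 Ty
  set D := {j ∈ nearPairs B 8 | j.1 ≠ j.2} with hD
  have hDcard : (#D : ℝ) ≤ 8 * N := by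
    have h1 := (card_filter_le (nearPairs B 8) (fun j => j.1 ≠ j.2)).trans
      (card_nearPairs_le B (T := 8) (by norm_num))
    rw [hBN] at h1
    have : #D ≤ 8 * N := by rw [hD]; omega
    exact_mod_cast this
  set g : ℝ × ℝ → ℝ × ℝ → ℕ := fun j i => #(shearPairs A (pairRatio i j) (pairShift i j)) with hg
  have htotal : N ^ 6 ≤ (#S * Ty) * ∑ j ∈ D, ∑ i ∈ D, g j i := by
    calc N ^ 6 = (N ^ 3) ^ 2 := by ring
      _ ≤ _ := Nat.pow_le_pow_left hP 2
      _ ≤ _ := hcoll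
      _ ≤ _ := Nat.mul_le_mul (card_nearPairs_le S hTy0) hsum
  have htotal' : (N : ℝ) ^ 6 ≤ (#S * Ty) * ∑ j ∈ D, ∑ i ∈ D, (g j i : ℝ) := by
    exact_mod_cast htotal
  generalize hs : (#S : ℝ) = s at *
  have hs0 : 0 < s := by linarith
  have hlow : 72 * θ * N ^ 4 ≤ ∑ j ∈ D, ∑ i ∈ D, (g j i : ℝ) := by
    generalize ∑ j ∈ D, ∑ i ∈ D, (g j i : ℝ) = W at htotal' ⊢
    by_contra! hcon
    have h1 : s * Ty ≤ 9 * s ^ 2 / N := by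
      calc s * Ty ≤ s * (9 * s / N) := by gcongr
        _ = _ := by ring
    have h2 : 0 < s * Ty := mul_pos hs0 (by exact_mod_cast hTy0)
    have h3 : (N : ℝ) ^ 6 < 9 * s ^ 2 / N * (72 * θ * N ^ 4) :=
      htotal'.trans_lt ((mul_lt_mul_of_pos_left hcon h2).trans_le
        (mul_le_mul_of_nonneg_right h1 (by positivity)))
    have h4 : 9 * s ^ 2 / N * (72 * θ * N ^ 4) = (648 * θ * s ^ 2) * N ^ 3 := by
      field_simp; ring
    rw [h4] at h3
    have h5 : (648 * θ * s ^ 2) * N ^ 3 ≤ N ^ 3 * (N : ℝ) ^ 3 := by gcongr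
    nlinarith
  obtain ⟨j, hj, hjlow⟩ : ∃ j ∈ D, 9 * θ * N ^ 3 ≤ ∑ i ∈ D, (g j i : ℝ) := by
    by_contra! hcon
    have h1 : ∑ j ∈ D, ∑ i ∈ D, (g j i : ℝ) < 72 * θ * N ^ 4 := by
      rcases D.eq_empty_or_nonempty with h0 | h0
      · rw [h0, sum_empty]; positivity
      · calc ∑ j ∈ D, ∑ i ∈ D, (g j i : ℝ) < ∑ j ∈ D, 9 * θ * (N : ℝ) ^ 3 :=
              sum_lt_sum_of_nonempty h0 hcon
          _ = #D * (9 * θ * (N : ℝ) ^ 3) := by rw [sum_const, nsmul_eq_mul]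
          _ ≤ 8 * N * (9 * θ * (N : ℝ) ^ 3) := by gcongr
          _ = _ := by ring
    linarith
  refine ⟨D, j, (mem_filter.1 hj).2, ?_⟩
  have hpop := sum_le_card_popular_mul_add D (fun i => (g j i : ℝ)) (t := θ * N ^ 2)
    (M := (N : ℝ) ^ 2) (by positivity) (fun i _ => by
      have : g j i ≤ N ^ 2 := by
        refine (card_filter_le _ _).trans ?_
        rw [card_product, hAN, sq]
      exact_mod_cast this)
  have h2 : (#D : ℝ) * (θ * N ^ 2) ≤ 8 * N * (θ * N ^ 2) := by gcongr
  have h3 : θ * N * (N : ℝ) ^ 2 ≤ #{i ∈ D | θ * N ^ 2 ≤ (g j i : ℝ)} * (N : ℝ) ^ 2 := by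
    nlinarith
  exact le_of_mul_le_mul_right h3 (by positivity)

lemma card_rich_ratios_lower {A B S X : Finset ℝ} {N : ℕ} {θ : ℝ} (hA : ∀ a ∈ A, 0 < a)
    (hAN : #A = N) (hBN : #B = N) (hN : 4 ≤ N)
    (hS : ∀ a ∈ A, ∀ c ∈ A, ∀ b ∈ B, c + a * b ∈ S)
    (hθ : 0 < θ) (hSθ : 648 * θ * (#S : ℝ) ^ 2 ≤ (N : ℝ) ^ 3)
    (hX : ∀ ρ : ℝ, θ * N ≤ #{a ∈ A | a * ρ ∈ A} → ρ ∈ X) :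
    θ ^ 4 * N ≤ 512 * #X := by
  have hN' : (4 : ℝ) ≤ N := by exact_mod_cast hN
  obtain ⟨D, j, hj, hI⟩ := exists_pair_many_shearPairs hA hAN hBN hN hS hθ hSθ
  set I := {i ∈ D | θ * N ^ 2 ≤ #(shearPairs A (pairRatio i j) (pairShift i j))} with hIdef
  set Sh := I.image (fun i => pairShift i j) with hSh
  have hIX : #I ≤ #X * #Sh := by
    rw [← card_product]
    apply card_le_card_of_injOn (fun i => (pairRatio i j, pairShift i j))
    · intro i hi
      have hi' : i ∈ I := hi
      simp only [coe_product, Set.mem_prod, mem_coe]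
      refine ⟨hX _ ?_, mem_image_of_mem _ hi'⟩
      have h1 := (mem_filter.1 hi').2
      have h2 : #(shearPairs A (pairRatio i j) (pairShift i j)) ≤
          #{a ∈ A | a * pairRatio i j ∈ A} * N := by
        rw [← hAN, ← card_product]
        apply card_le_card
        intro p hp
        simp only [shearPairs, mem_filter, mem_product] at hp ⊢
        exact ⟨⟨hp.1.1, hp.2.1⟩, hp.1.2⟩
      have h2' : (#(shearPairs A (pairRatio i j) (pairShift i j)) : ℝ) ≤
          #{a ∈ A | a * pairRatio i j ∈ A} * N := by exact_mod_cast h2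
      have h3 : θ * N * N ≤ #{a ∈ A | a * pairRatio i j ∈ A} * (N : ℝ) := by
        refine le_trans ?_ h2'
        linarith
      exact le_of_mul_le_mul_right h3 (by linarith)
    · intro i _ k _ h
      simp only [Prod.mk.injEq] at h
      obtain ⟨h1, h2⟩ := h
      have h0 : j.2 - j.1 ≠ 0 := sub_ne_zero.2 (Ne.symm hj)
      have h3 : i.1 = k.1 := by
        simp only [pairShift, h1] at h2
        linarith
      simp only [pairRatio] at h1
      rw [div_left_inj' h0] at h1
      exact Prod.ext h3 (by linarith)
  have hE : θ * N ^ 2 * #Sh ≤ #(hits A A Sh A) := by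
    have h1 : #(hits A A Sh A) = ∑ σ ∈ Sh, #{p ∈ hits A A Sh A | p.2.2 = σ} :=
      card_eq_sum_card_fiberwise (fun p hp => by
        have := (mem_filter.1 (mem_coe.1 hp)).1
        simp only [mem_product] at this
        exact this.2.2)
    rw [h1, mul_comm, ← nsmul_eq_mul]
    push_cast
    apply card_nsmul_le_sum
    intro σ hσ
    obtain ⟨i, hi, rfl⟩ := mem_image.1 hσ
    refine ((mem_filter.1 hi).2).trans ?_
    have : #(shearPairs A (pairRatio i j) (pairShift i j)) ≤
        #{p ∈ hits A A Sh A | p.2.2 = pairShift i j} := by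
      apply card_le_card_of_injOn (fun p => (p.1, p.2, pairShift i j))
      · intro p hp
        simp only [shearPairs, coe_filter, mem_product, Set.mem_ofPred_eq] at hp
        simp [hits, hp.1.1, hp.1.2, hp.2.2, hσ]
      · intro p _ q _ h
        simp only [Prod.mk.injEq] at h
        exact Prod.ext h.1 h.2.1
    exact_mod_cast this
  have hinc := card_hits_le (X := Sh) hA hAN hAN hAN
  have hinc' : (#(hits A A Sh A) : ℝ) ^ 3 ≤ 512 * (#Sh : ℝ) ^ 2 * N ^ 6 := by exact_mod_cast hinc
  have hIX' : (#I : ℝ) ≤ #X * #Sh := by exact_mod_cast hIX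
  have hIpos : (0 : ℝ) < #I := lt_of_lt_of_le (by positivity) hI
  generalize (#(hits A A Sh A) : ℝ) = E at *
  generalize hk : (#Sh : ℝ) = k at *
  have hk0 : 0 ≤ k := by rw [← hk]; exact Nat.cast_nonneg _
  have hx0 : (0 : ℝ) ≤ #X := Nat.cast_nonneg _
  have hkpos : 0 < k := by
    rcases hk0.eq_or_lt with h | h
    · rw [← h] at hIX'; linarith
    · exact h
  have h1 : (θ * N ^ 2 * k) ^ 3 ≤ 512 * k ^ 2 * N ^ 6 :=
    (pow_le_pow_left₀ (by positivity) hE 3).trans hinc'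
  have h2 : (θ ^ 3 * k) * (k ^ 2 * N ^ 6) ≤ 512 * (k ^ 2 * (N : ℝ) ^ 6) := by
    calc (θ ^ 3 * k) * (k ^ 2 * N ^ 6) = (θ * N ^ 2 * k) ^ 3 := by ring
      _ ≤ 512 * k ^ 2 * N ^ 6 := h1
      _ = _ := by ring
  have h3 : θ ^ 3 * k ≤ 512 := le_of_mul_le_mul_right h2 (by positivity)
  calc θ ^ 4 * N = θ ^ 3 * (θ * N) := by ring
    _ ≤ θ ^ 3 * (#X * k) := mul_le_mul_of_nonneg_left (hI.trans hIX') (by positivity)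
    _ = #X * (θ ^ 3 * k) := by ring
    _ ≤ #X * 512 := by gcongr
    _ = _ := by ring


/-- Solutions `(b, h)` of `α b + β h ∈ Y`. -/
noncomputable def linearSolutions (B H Y : Finset ℝ) (α β : ℝ) : Finset (ℝ × ℝ) :=
  (B ×ˢ H).filter fun p => α * p.1 + β * p.2 ∈ Y

lemma card_linearSolutions_le {A B H X Y : Finset ℝ} {N : ℕ} {t α β : ℝ} (hA : ∀ a ∈ A, 0 < a)
    (hX : ∀ x ∈ X, 0 < x) (hAN : #A = N) (hBN : #B = N) (hYN : #Y = N) (ht : 0 ≤ t)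
    (hH : ∀ h ∈ H, t ≤ #{x ∈ X | h * x ∈ A}) (hα : α ≠ 0) (hβ : β ≠ 0) :
    (#(linearSolutions B H Y α β) * t) ^ 3 ≤ 512 * (#X : ℝ) ^ 2 * N ^ 6 := by
  set C := B.image (fun b => α * b) with hC
  set Z := X.image (fun x => β / x) with hZ
  have hCN : #C = N := by
    rw [hC, card_image_of_injective _ (mul_right_injective₀ hα), hBN]
  have hZX : #Z ≤ #X := card_image_le
  have h1 := card_hits_le (X := Z) hA hAN hCN hYN
  have h2 : #(linearSolutions B H Y α β) * t ≤ #(hits A C Z Y) := by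
    calc #(linearSolutions B H Y α β) * t
        ≤ ∑ p ∈ linearSolutions B H Y α β, (#{x ∈ X | p.2 * x ∈ A} : ℝ) := by
          rw [← nsmul_eq_mul]
          apply card_nsmul_le_sum
          intro p hp
          simp only [linearSolutions, mem_filter, mem_product] at hp
          exact hH _ hp.1.2
      _ ≤ #(hits A C Z Y) := by
          rw [← Nat.cast_sum, ← card_sigma (linearSolutions B H Y α β)
            (fun p => {x ∈ X | p.2 * x ∈ A})]
          norm_cast
          apply card_le_card_of_injOn (fun s => (s.1.2 * s.2, α * s.1.1, β / s.2))
          · rintro ⟨⟨b, h⟩, x⟩ hp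
            simp only [linearSolutions, coe_sigma, Set.mem_sigma_iff, mem_coe, mem_filter,
              mem_product] at hp
            obtain ⟨⟨⟨hb, -⟩, hy⟩, hx, hhx⟩ := hp
            have hx0 := (hX x hx).ne'
            have e : α * b + h * x * (β / x) = α * b + β * h := by field_simp
            simp only [hits, coe_filter, mem_product, Set.mem_ofPred_eq, e]
            exact ⟨⟨hhx, mem_image_of_mem _ hb, mem_image_of_mem _ hx⟩, hy⟩
          · rintro ⟨⟨b, h⟩, x⟩ hp ⟨⟨b', h'⟩, x'⟩ hq he
            simp only [coe_sigma, Set.mem_sigma_iff, mem_coe, mem_filter] at hp hq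
            simp only [Prod.mk.injEq] at he
            obtain ⟨e1, e2, e3⟩ := he
            have hx0 := (hX x hp.2.1).ne'
            have hx0' := (hX x' hq.2.1).ne'
            have hb : b = b' := mul_left_cancel₀ hα e2
            have hxx : x = x' := by
              field_simp at e3
              exact e3.symm
            subst hxx hb
            have : h = h' := mul_right_cancel₀ hx0 e1
            rw [this]
  calc (#(linearSolutions B H Y α β) * t) ^ 3 ≤ (#(hits A C Z Y) : ℝ) ^ 3 :=
        pow_le_pow_left₀ (by positivity) h2 3
    _ ≤ 512 * (#Z : ℝ) ^ 2 * N ^ 6 := by exact_mod_cast h1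
    _ ≤ _ := by gcongr

/-- Sums of a point `b (p, p x)`, `b ∈ B`, of the line of slope `x` and a point `(h, h y)` of the
line of slope `y`, where `h ∈ H` and `h y ∈ A`. -/
noncomputable def sectorSums (A B H : Finset ℝ) (p x y : ℝ) : Finset (ℝ × ℝ) :=
  (B ×ˢ {h ∈ H | h * y ∈ A}).image fun s => (s.1 * p + s.2, s.1 * p * x + s.2 * y)

lemma card_sectorSums {A B H : Finset ℝ} {p x y : ℝ} (hp : p ≠ 0) (hxy : x ≠ y) :
    #(sectorSums A B H p x y) = #B * #{h ∈ H | h * y ∈ A} := by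
  rw [sectorSums, card_image_of_injective, card_product]
  rintro ⟨b, h⟩ ⟨b', h'⟩ he
  simp only [Prod.mk.injEq] at he
  obtain ⟨e1, e2⟩ := he
  have hb : b = b' := by
    apply mul_right_cancel₀ (mul_ne_zero hp (sub_ne_zero.2 hxy))
    linear_combination e2 - y * e1
  subst hb
  have : h = h' := by linear_combination e1
  rw [this]

lemma sector_of_mem_sectorSums {A B H : Finset ℝ} {p x y : ℝ} {z : ℝ × ℝ}
    (hB : ∀ b ∈ B, 0 < b) (hH : ∀ h ∈ H, 0 < h) (hp : 0 < p) (hxy : x < y)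
    (hz : z ∈ sectorSums A B H p x y) : 0 < z.1 ∧ x * z.1 < z.2 ∧ z.2 < y * z.1 := by
  obtain ⟨⟨b, h⟩, hs, rfl⟩ := mem_image.1 hz
  simp only [mem_product, mem_filter] at hs
  have hb := hB b hs.1
  have hh := hH h hs.2.1
  have h1 : 0 < b * p := mul_pos hb hp
  exact ⟨by positivity, by nlinarith, by nlinarith⟩

lemma card_inter_sectorSums_le {A B H : Finset ℝ} {J p x y p' x' y' : ℝ}
    (hJB : ∀ α β : ℝ, α ≠ 0 → β ≠ 0 → (#(linearSolutions B H B α β) : ℝ) ≤ J)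
    (hJA : ∀ α β : ℝ, α ≠ 0 → β ≠ 0 → (#(linearSolutions B H A α β) : ℝ) ≤ J)
    (hHA : H ⊆ A) (hp : p ≠ 0) (hp' : p' ≠ 0) (hxy : x < y) (hxy' : x' < y')
    (hne : (x, y) ≠ (x', y')) :
    (#(sectorSums A B H p x y ∩ sectorSums A B H p' x' y') : ℝ) ≤ J := by
  have key : ∀ (α β : ℝ) (Y : Finset ℝ),
      (∀ b ∈ B, ∀ h ∈ H, ∀ b' ∈ B, ∀ h' ∈ H, b * p + h = b' * p' + h' →
        b * p * x + h * y = b' * p' * x' + h' * y' → α * b + β * h ∈ Y) →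
      #(sectorSums A B H p x y ∩ sectorSums A B H p' x' y') ≤ #(linearSolutions B H Y α β) := by
    intro α β Y hY
    refine (card_le_card (t := (linearSolutions B H Y α β).image
      fun s => (s.1 * p + s.2, s.1 * p * x + s.2 * y)) ?_).trans card_image_le
    intro z hz
    obtain ⟨hz1, hz2⟩ := mem_inter.1 hz
    obtain ⟨⟨b, h⟩, hs, rfl⟩ := mem_image.1 hz1
    obtain ⟨⟨b', h'⟩, hs', he⟩ := mem_image.1 hz2
    simp only [mem_product, mem_filter] at hs hs'
    simp only [Prod.mk.injEq] at he
    refine mem_image.2 ⟨(b, h), ?_, rfl⟩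
    simp only [linearSolutions, mem_filter, mem_product]
    exact ⟨⟨hs.1, hs.2.1⟩, hY b hs.1 h hs.2.1 b' hs'.1 h' hs'.2.1 he.1.symm he.2.symm⟩
  have h0 : x' - y' ≠ 0 := sub_ne_zero.2 hxy'.ne
  have h0' : y' - x' ≠ 0 := sub_ne_zero.2 hxy'.ne'
  by_cases hcase : x ≠ y' ∧ y ≠ y'
  · obtain ⟨h1, h2⟩ := hcase
    refine le_trans (Nat.cast_le.2 (key (p * (x - y') / (p' * (x' - y')))
      ((y - y') / (p' * (x' - y'))) B ?_)) (hJB _ _ ?_ ?_)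
    · intro b _ h _ b' hb' h' _ e1 e2
      have : p * (x - y') / (p' * (x' - y')) * b + (y - y') / (p' * (x' - y')) * h = b' := by
        field_simp
        linear_combination e2 - y' * e1
      rwa [this]
    · exact div_ne_zero (mul_ne_zero hp (sub_ne_zero.2 h1)) (mul_ne_zero hp' h0)
    · exact div_ne_zero (sub_ne_zero.2 h2) (mul_ne_zero hp' h0)
  · have h1 : x ≠ x' := by
      rintro rfl
      refine hcase ⟨hxy'.ne, fun h => hne (by rw [h])⟩
    have h2 : y ≠ x' := by
      rintro rfl
      exact hcase ⟨(hxy.trans hxy').ne, hxy'.ne⟩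
    refine le_trans (Nat.cast_le.2 (key (p * (x - x') / (y' - x'))
      ((y - x') / (y' - x')) A ?_)) (hJA _ _ ?_ ?_)
    · intro b _ h _ b' _ h' hh' e1 e2
      have : p * (x - x') / (y' - x') * b + (y - x') / (y' - x') * h = h' := by
        field_simp
        linear_combination e2 - x' * e1
      rw [this]
      exact hHA hh'
    · exact div_ne_zero (mul_ne_zero hp (sub_ne_zero.2 h1)) h0'
    · exact div_ne_zero (sub_ne_zero.2 h2) h0'

lemma card_mul_le_card_of_few_overlaps {ι β : Type*} [DecidableEq ι] [DecidableEq β]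
    {F : Finset ι} {Q : ι → Finset β} {U : Finset β} {q J : ℝ} {m : ℕ}
    (hU : ∀ f ∈ F, Q f ⊆ U) (hq : ∀ f ∈ F, q ≤ #(Q f)) (hJ0 : 0 ≤ J)
    (hJ : ∀ f ∈ F, ∀ g ∈ F, g ≠ f → (#(Q f ∩ Q g) : ℝ) ≤ J)
    (hm : ∀ f ∈ F, #{g ∈ F | g ≠ f ∧ (Q f ∩ Q g).Nonempty} ≤ m) (hmJ : m * J ≤ q / 2) :
    #F * (q / 2) ≤ #U := by
  set O : ι → Finset ι := fun f => {g ∈ F | g ≠ f ∧ (Q f ∩ Q g).Nonempty} with hO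
  set R : ι → Finset β := fun f => Q f \ (O f).biUnion (fun g => Q f ∩ Q g) with hR
  have hRq : ∀ f ∈ F, q / 2 ≤ #(R f) := by
    intro f hf
    have h1 : (#((O f).biUnion (fun g => Q f ∩ Q g)) : ℝ) ≤ q / 2 := by
      calc (#((O f).biUnion (fun g => Q f ∩ Q g)) : ℝ)
          ≤ ∑ g ∈ O f, (#(Q f ∩ Q g) : ℝ) := by exact_mod_cast card_biUnion_le
        _ ≤ #(O f) • J := sum_le_card_nsmul _ _ _ fun g hg =>
            hJ f hf g (mem_filter.1 hg).1 (mem_filter.1 hg).2.1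
        _ ≤ m * J := by
            rw [nsmul_eq_mul]
            exact mul_le_mul_of_nonneg_right (by exact_mod_cast hm f hf) hJ0
        _ ≤ q / 2 := hmJ
    have h2 : #(Q f) ≤ #(R f) + #((O f).biUnion (fun g => Q f ∩ Q g)) := by
      have := le_card_sdiff ((O f).biUnion (fun g => Q f ∩ Q g)) (Q f)
      simp only [hR]
      omega
    have h2' : (#(Q f) : ℝ) ≤ #(R f) + #((O f).biUnion (fun g => Q f ∩ Q g)) := by
      exact_mod_cast h2
    have := hq f hf
    linarith
  have hdisj : (F : Set ι).PairwiseDisjoint R := by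
    intro f hf g hg hfg
    rw [Function.onFun, disjoint_left]
    intro z hz hz'
    have h1 := mem_sdiff.1 hz
    have h2 := mem_sdiff.1 hz'
    exact h1.2 (mem_biUnion.2 ⟨g, mem_filter.2 ⟨hg, hfg.symm, z, mem_inter.2 ⟨h1.1, h2.1⟩⟩,
      mem_inter.2 ⟨h1.1, h2.1⟩⟩)
  calc #F * (q / 2) = #F • (q / 2) := by rw [nsmul_eq_mul]
    _ ≤ ∑ f ∈ F, (#(R f) : ℝ) := card_nsmul_le_sum _ _ _ hRq
    _ = #(F.biUnion R) := by rw [card_biUnion hdisj]; push_cast; rfl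
    _ ≤ #U := by
      norm_cast
      exact card_le_card (biUnion_subset.2 fun f hf => sdiff_subset.trans (hU f hf))

lemma card_mul_le_sq_card_of_slopes {A B H S : Finset ℝ} {n M : ℕ} {v : ℕ → ℝ} {t J : ℝ}
    (hB : ∀ b ∈ B, 0 < b) (hA : ∀ a ∈ A, 0 < a)
    (hS : ∀ a ∈ A, ∀ c ∈ A, ∀ b ∈ B, c + a * b ∈ S) (hHA : H ⊆ A)
    (hv : ∀ i j, i < j → j < n → v i < v j)
    (ht : 0 < t) (hrich : ∀ i < n, t ≤ #{h ∈ H | h * v i ∈ A}) (hJ0 : 0 ≤ J)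
    (hJB : ∀ α β : ℝ, α ≠ 0 → β ≠ 0 → (#(linearSolutions B H B α β) : ℝ) ≤ J)
    (hJA : ∀ α β : ℝ, α ≠ 0 → β ≠ 0 → (#(linearSolutions B H A α β) : ℝ) ≤ J)
    (hMJ : (2 * M * M : ℕ) * J ≤ #B * t / 2) :
    ((n - M) * M : ℕ) * (#B * t / 2) ≤ (#S : ℝ) ^ 2 := by
  have hex : ∀ i, ∃ p, i < n → p ∈ H ∧ p * v i ∈ A := by
    intro i
    by_cases hi : i < n
    · have h1 : (0 : ℝ) < #{h ∈ H | h * v i ∈ A} := ht.trans_le (hrich i hi)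
      obtain ⟨p, hp⟩ := card_pos.1 (by exact_mod_cast h1 : 0 < #{h ∈ H | h * v i ∈ A})
      exact ⟨p, fun _ => mem_filter.1 hp⟩
    · exact ⟨0, fun h => absurd h hi⟩
  choose p hp using hex
  have hH : ∀ h ∈ H, 0 < h := fun h hh => hA h (hHA hh)
  have hp0 : ∀ i < n, 0 < p i := fun i hi => hH _ (hp i hi).1
  have hinj : ∀ i j, i < n → j < n → v i = v j → i = j := by
    intro i j hi hj h
    rcases lt_trichotomy i j with h1 | h1 | h1
    · exact absurd h (hv i j h1 hj).ne
    · exact h1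
    · exact absurd h (hv j i h1 hi).ne'
  have hlt : ∀ i j, i < n → j < n → v i < v j → i < j := by
    intro i j hi hj h
    by_contra! hcon
    rcases hcon.eq_or_lt with h1 | h1
    · rw [h1] at h; exact lt_irrefl _ h
    · exact lt_asymm h (hv j i h1 hi)
  have hF : ∀ f ∈ range (n - M) ×ˢ range M, f.1 < f.1 + f.2 + 1 ∧ f.1 + f.2 + 1 < n ∧ f.2 < M := by
    intro f hf
    simp only [mem_product, mem_range] at hf
    omega
  have h := card_mul_le_card_of_few_overlaps (F := range (n - M) ×ˢ range M)
    (Q := fun f => sectorSums A B H (p f.1) (v f.1) (v (f.1 + f.2 + 1))) (U := S ×ˢ S)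
    (q := #B * t) (J := J) (m := 2 * M * M) ?_ ?_ hJ0 ?_ ?_ hMJ
  · rw [card_product, card_range, card_range, card_product] at h
    rw [sq]
    exact_mod_cast h
  · intro f hf z hz
    obtain ⟨h1, h2, h3⟩ := hF f hf
    obtain ⟨⟨b, h⟩, hs, rfl⟩ := mem_image.1 hz
    simp only [mem_product, mem_filter] at hs
    obtain ⟨hb, hh, hhv⟩ := hs
    obtain ⟨hpH, hpv⟩ := hp f.1 (by omega)
    refine mem_product.2 ⟨?_, ?_⟩
    · have := hS _ (hHA hpH) _ (hHA hh) b hb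
      convert this using 1
      ring
    · have := hS _ hpv _ hhv b hb
      convert this using 1
      ring
  · intro f hf
    obtain ⟨h1, h2, h3⟩ := hF f hf
    rw [card_sectorSums (hp0 _ (by omega)).ne' (hv _ _ h1 h2).ne]
    push_cast
    exact mul_le_mul_of_nonneg_left (hrich _ h2) (Nat.cast_nonneg _)
  · intro f hf g hg hne
    obtain ⟨h1, h2, h3⟩ := hF f hf
    obtain ⟨k1, k2, k3⟩ := hF g hg
    refine card_inter_sectorSums_le hJB hJA hHA (hp0 _ (by omega)).ne' (hp0 _ (by omega)).ne'
      (hv _ _ h1 h2) (hv _ _ k1 k2) ?_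
    intro he
    simp only [Prod.mk.injEq] at he
    have e1 := hinj _ _ (by omega) (by omega) he.1
    have e2 := hinj _ _ h2 k2 he.2
    exact hne (Prod.ext e1.symm (by omega))
  · intro f hf
    obtain ⟨h1, h2, h3⟩ := hF f hf
    have hclose : ∀ g ∈ range (n - M) ×ˢ range M,
        (sectorSums A B H (p f.1) (v f.1) (v (f.1 + f.2 + 1)) ∩
          sectorSums A B H (p g.1) (v g.1) (v (g.1 + g.2 + 1))).Nonempty →
        f.1 < g.1 + M ∧ g.1 < f.1 + M := by
      rintro g hg ⟨z, hz⟩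
      obtain ⟨k1, k2, k3⟩ := hF g hg
      obtain ⟨hz1, hz2⟩ := mem_inter.1 hz
      have a := sector_of_mem_sectorSums hB hH (hp0 _ (by omega)) (hv _ _ h1 h2) hz1
      have b := sector_of_mem_sectorSums hB hH (hp0 _ (by omega)) (hv _ _ k1 k2) hz2
      have c1 : v f.1 < v (g.1 + g.2 + 1) :=
        lt_of_mul_lt_mul_right (a.2.1.trans b.2.2) a.1.le
      have c2 : v g.1 < v (f.1 + f.2 + 1) :=
        lt_of_mul_lt_mul_right (b.2.1.trans a.2.2) a.1.le
      have := hlt _ _ (by omega) k2 c1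
      have := hlt _ _ (by omega) h2 c2
      omega
    have hc : 2 * M * M = #(range (2 * M) ×ˢ range M) := by simp
    rw [hc]
    apply card_le_card_of_injOn (fun g => (g.1 + M - f.1, g.2))
    · intro g hg
      simp only [coe_filter, Set.mem_ofPred_eq] at hg
      have := hclose g hg.1 hg.2.2
      have := hF g hg.1
      simp only [coe_product, Set.mem_prod, mem_coe, mem_range]
      omega
    · intro g hg g' hg' he
      simp only [coe_filter, Set.mem_ofPred_eq] at hg hg'
      have := hclose g hg.1 hg.2.2
      have := hclose g' hg'.1 hg'.2.2
      simp only [Prod.mk.injEq] at he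
      exact Prod.ext (by omega) he.2


lemma card_popular_slopes {A X : Finset ℝ} {N : ℕ} {θ : ℝ} (hAN : #A = N) (hN : 0 < N)
    (hθ : 0 < θ) (hX : ∀ x ∈ X, θ * N ≤ #{a ∈ A | a * x ∈ A}) :
    θ * #X / 4 ≤ #{x ∈ X | θ * N / 4 ≤
      #{h ∈ {a ∈ A | θ * #X / 2 ≤ #{x ∈ X | a * x ∈ A}} | h * x ∈ A}} := by
  set H := {a ∈ A | θ * #X / 2 ≤ #{x ∈ X | a * x ∈ A}} with hH
  have swap : ∀ W : Finset ℝ, ∑ a ∈ W, (#{x ∈ X | a * x ∈ A} : ℝ) =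
      ∑ x ∈ X, (#{a ∈ W | a * x ∈ A} : ℝ) := fun W => by
    exact_mod_cast sum_card_bipartiteAbove_eq_sum_card_bipartiteBelow
      (s := W) (t := X) (fun a x => a * x ∈ A)
  have hN' : (0 : ℝ) < N := by exact_mod_cast hN
  have h1 : #X * (θ * N) ≤ ∑ a ∈ A, (#{x ∈ X | a * x ∈ A} : ℝ) := by
    rw [swap, ← nsmul_eq_mul]
    exact card_nsmul_le_sum _ _ _ hX
  have h2 : ∑ a ∈ A, (#{x ∈ X | a * x ∈ A} : ℝ) ≤
      ∑ a ∈ H, (#{x ∈ X | a * x ∈ A} : ℝ) + N * (θ * #X / 2) := by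
    rw [← sum_filter_add_sum_filter_not A (fun a => θ * #X / 2 ≤ #{x ∈ X | a * x ∈ A})]
    gcongr
    refine (sum_le_card_nsmul _ _ (θ * #X / 2) fun a ha =>
      (not_le.1 (mem_filter.1 ha).2).le).trans ?_
    rw [nsmul_eq_mul, ← hAN]
    gcongr
    exact filter_subset _ _
  rw [swap H] at h2
  have h3 := sum_le_card_popular_mul_add X (fun x => (#{h ∈ H | h * x ∈ A} : ℝ))
    (t := θ * N / 4) (M := N) (by positivity) (fun x _ => by
      have : #{h ∈ H | h * x ∈ A} ≤ N := by
        rw [← hAN]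
        exact card_le_card ((filter_subset _ _).trans (filter_subset _ _))
      exact_mod_cast this)
  have h4 : θ * #X / 4 * N ≤
      #{x ∈ X | θ * N / 4 ≤ (#{h ∈ H | h * x ∈ A} : ℝ)} * (N : ℝ) := by
    linarith
  exact le_of_mul_le_mul_right h4 hN'

lemma exists_increasing_enumeration (X : Finset ℝ) : ∃ v : ℕ → ℝ,
    (∀ i < #X, v i ∈ X) ∧ ∀ i j, i < j → j < #X → v i < v j := by
  refine ⟨fun i => if h : i < #X then X.orderEmbOfFin rfl ⟨i, h⟩ else 0, ?_, ?_⟩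
  · intro i hi
    simp [hi]
  · intro i j hij hj
    simp [hj, hij.trans hj, hij]

lemma pow_le_card_of_card_eq_pow {A B S : Finset ℝ} {N : ℕ} {u : ℝ} (hA : ∀ a ∈ A, 0 < a)
    (hB : ∀ b ∈ B, 0 < b) (hAN : #A = N) (hBN : #B = N)
    (hS : ∀ a ∈ A, ∀ c ∈ A, ∀ b ∈ B, c + a * b ∈ S)
    (hu : 5000 ≤ u) (hNu : (N : ℝ) = u ^ 200) : u ^ 301 ≤ (#S : ℝ) := by
  by_contra! hcon
  have hu0 : 0 < u := by linarith
  have hu1 : 1 ≤ u := by linarith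
  have step : ∀ {k m : ℕ}, k + 1 = m → 5000 * u ^ k ≤ u ^ m := fun {k m} hkm => by
    subst hkm
    rw [pow_succ, mul_comm]; gcongr
  have hN4 : 4 ≤ N := by
    have h1 := le_self_pow₀ hu1 (n := 200) (by norm_num)
    have : (4 : ℝ) ≤ N := by rw [hNu]; linarith
    exact_mod_cast this
  have hs2 : (#S : ℝ) ^ 2 < u ^ 602 := by
    calc (#S : ℝ) ^ 2 < (u ^ 301) ^ 2 := by gcongr
      _ = u ^ 602 := by rw [← pow_mul]
  set θ : ℝ := (u ^ 3)⁻¹ with hθ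
  have hθ0 : 0 < θ := by positivity
  have hθu : ∀ k : ℕ, θ * u ^ (k + 3) = u ^ k := fun k => by
    rw [hθ, pow_add]; field_simp
  have hθN : θ * N = u ^ 197 := by rw [hNu]; exact hθu 197
  set X : Finset ℝ := {x ∈ (A ×ˢ A).image (fun p => p.1 / p.2) | θ * N ≤ #{a ∈ A | a * x ∈ A}}
    with hX
  have hXpos : ∀ x ∈ X, 0 < x := by
    intro x hx
    obtain ⟨p, hp, rfl⟩ := mem_image.1 (mem_filter.1 hx).1
    rw [mem_product] at hp
    exact div_pos (hA _ hp.1) (hA _ hp.2)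
  have hXL : u ^ 187 ≤ (#X : ℝ) := by
    have h1 := card_rich_ratios_lower (X := X) hA hAN hBN hN4 hS hθ0 (by
      have h3 : θ * (#S : ℝ) ^ 2 ≤ u ^ 599 := by
        rw [← hθu 599]; gcongr
      have h4 := step (show 599 + 1 = 600 from rfl)
      have h5 : (N : ℝ) ^ 3 = u ^ 600 := by rw [hNu, ← pow_mul]
      rw [h5, mul_assoc]
      linarith [pow_pos hu0 599]) (by
      intro ρ hρ
      have h1 : (0 : ℝ) < #{a ∈ A | a * ρ ∈ A} :=
        lt_of_lt_of_le (by rw [hθN]; positivity) hρ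
      obtain ⟨a, ha⟩ := card_pos.1 (by exact_mod_cast h1 : 0 < #{a ∈ A | a * ρ ∈ A})
      obtain ⟨ha1, ha2⟩ := mem_filter.1 ha
      refine mem_filter.2 ⟨mem_image.2 ⟨(a * ρ, a), mem_product.2 ⟨ha2, ha1⟩, ?_⟩, hρ⟩
      exact mul_div_cancel_left₀ _ (hA a ha1).ne')
    have h2 : θ ^ 4 * N = u ^ 188 := by
      calc θ ^ 4 * N = θ * (θ * (θ * (θ * N))) := by ring
        _ = u ^ 188 := by rw [hθN, hθu 194, hθu 191, hθu 188]
    have := step (show 187 + 1 = 188 from rfl)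
    linarith [pow_pos hu0 187]
  have hslopes := card_popular_slopes hAN (by omega) hθ0 (fun x hx => (mem_filter.1 hx).2)
    (X := X)
  set H := {a ∈ A | θ * #X / 2 ≤ #{x ∈ X | a * x ∈ A}} with hH
  set X' := {x ∈ X | θ * N / 4 ≤ (#{h ∈ H | h * x ∈ A} : ℝ)} with hX'
  have hn : u ^ 183 ≤ (#X' : ℝ) := by
    have h1 : u ^ 184 ≤ θ * #X := by rw [← hθu 184]; gcongr
    have := step (show 183 + 1 = 184 from rfl)
    linarith [pow_pos hu0 183]
  obtain ⟨v, hvmem, hvmono⟩ := exists_increasing_enumeration X'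
  have hJ : ∀ Y : Finset ℝ, #Y = N → ∀ α β : ℝ, α ≠ 0 → β ≠ 0 →
      (#(linearSolutions B H Y α β) : ℝ) ≤ u ^ 341 := by
    intro Y hY α β hα hβ
    have h1 := card_linearSolutions_le (H := H) (t := θ * #X / 2) hA hXpos hAN hBN hY
      (by positivity) (fun h hh => (mem_filter.1 hh).2) hα hβ
    generalize (#(linearSolutions B H Y α β) : ℝ) = j at h1 ⊢
    have hL0 : 0 < (#X : ℝ) := lt_of_lt_of_le (by positivity) hXL
    generalize (#X : ℝ) = L at h1 hL0 hXL
    by_contra! hj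
    have h2 : (u ^ 341 * (θ * L / 2)) ^ 3 ≤ 512 * L ^ 2 * N ^ 6 := by
      refine le_trans ?_ h1
      gcongr
    have h3 : (u ^ 341 * (θ * L / 2)) ^ 3 = u ^ 1014 * L * L ^ 2 / 8 := by
      have e : u ^ 341 * (θ * L / 2) = u ^ 338 * L / 2 := by
        rw [← hθu 338]; ring
      rw [e]; ring
    have h4 : (N : ℝ) ^ 6 = u ^ 1200 := by rw [hNu, ← pow_mul]
    rw [h3, h4] at h2
    have h5 : (u ^ 1014 * L) * L ^ 2 ≤ (4096 * u ^ 1200) * L ^ 2 := by linarith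
    have h6 := le_of_mul_le_mul_right h5 (by positivity)
    have h7 : u ^ 1201 ≤ u ^ 1014 * L := by
      calc u ^ 1201 = u ^ 1014 * u ^ 187 := by rw [← pow_add]
        _ ≤ _ := by gcongr
    linarith [step (show 1200 + 1 = 1201 from rfl), pow_pos hu0 1200]
  obtain ⟨M, hM1, hM2⟩ : ∃ M : ℕ, (M : ℝ) ≤ u ^ 25 ∧ u ^ 25 / 2 ≤ M := by
    refine ⟨⌊u ^ 25⌋₊, Nat.floor_le (by positivity), ?_⟩
    have h1 := (Nat.lt_floor_add_one (u ^ 25)).le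
    have h2 := le_self_pow₀ hu1 (n := 25) (by norm_num)
    linarith
  have hbound := card_mul_le_sq_card_of_slopes (M := M) (t := θ * N / 4) (J := u ^ 341) hB hA hS
    (filter_subset _ _) hvmono (by rw [hθN]; positivity)
    (fun i hi => (mem_filter.1 (hvmem i hi)).2) (by positivity) (hJ B hBN) (hJ A hAN) (by
      rw [hBN, hθN, hNu]
      push_cast
      calc 2 * (M : ℝ) * M * u ^ 341 ≤ 2 * u ^ 25 * u ^ 25 * u ^ 341 := by gcongr
        _ = 2 * u ^ 391 := by ring
        _ ≤ u ^ 397 / 8 := by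
          have : u ^ 392 ≤ u ^ 397 := pow_le_pow_right₀ hu1 (by norm_num)
          linarith [step (show 391 + 1 = 392 from rfl), pow_pos hu0 391]
        _ = u ^ 200 * (u ^ 197 / 4) / 2 := by ring)
  rw [hBN, hθN, hNu] at hbound
  have hnM : u ^ 183 / 2 ≤ ((#X' - M : ℕ) : ℝ) := by
    have h1 : (#X' : ℝ) ≤ ((#X' - M : ℕ) : ℝ) + M := by
      have : #X' ≤ (#X' - M) + M := by omega
      exact_mod_cast this
    have h2 : u ^ 26 ≤ u ^ 183 := pow_le_pow_right₀ hu1 (by norm_num)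
    linarith [step (show 25 + 1 = 26 from rfl), pow_pos hu0 25]
  have hfinal : u ^ 605 / 32 ≤ (#S : ℝ) ^ 2 := by
    refine le_trans ?_ hbound
    push_cast
    calc u ^ 605 / 32 = u ^ 183 / 2 * (u ^ 25 / 2) * (u ^ 200 * (u ^ 197 / 4) / 2) := by ring
      _ ≤ _ := by gcongr
  have : u ^ 603 ≤ u ^ 605 := pow_le_pow_right₀ hu1 (by norm_num)
  linarith [step (show 602 + 1 = 603 from rfl), pow_pos hu0 602]

/-- There exist a real constant `c > 0`, a constant `C > 0` and a positive integer `n₀`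
such that for all finite sets `A`, `B` of positive real numbers with `|A| = |B| ≥ n₀`
one has `|AB+A| ≥ C·|A|^(3/2 + c)`. -/
theorem exists_lower_bound_AB_add_A :
    ∃ c : ℝ, 0 < c ∧ ∃ C : ℝ, 0 < C ∧ ∃ n₀ : ℕ, 0 < n₀ ∧
      ∀ A B : Finset ℝ, (∀ a ∈ A, 0 < a) → (∀ b ∈ B, 0 < b) →
        A.card = B.card → n₀ ≤ A.card →
        C * (A.card : ℝ) ^ ((3 : ℝ) / 2 + c) ≤
          (((A ×ˢ B ×ˢ A).image
            (fun p : ℝ × ℝ × ℝ => p.1 * p.2.1 + p.2.2)).card : ℝ) := by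
  obtain ⟨n₀, hn₀⟩ : ∃ n₀ : ℕ, ∀ N : ℕ, n₀ ≤ N → (5000 : ℝ) ≤ (N : ℝ) ^ (1 / 200 : ℝ) := by
    have h := ((tendsto_rpow_atTop (show (0 : ℝ) < 1 / 200 by norm_num)).comp
      tendsto_natCast_atTop_atTop).eventually_ge_atTop 5000
    exact Filter.eventually_atTop.1 h
  refine ⟨1 / 200, by norm_num, 1, one_pos, n₀ + 1, Nat.succ_pos _, ?_⟩
  intro A B hA hB hAB hn
  have hN0 : (0 : ℝ) ≤ #A := Nat.cast_nonneg _
  have key := pow_le_card_of_card_eq_pow (S := (A ×ˢ B ×ˢ A).image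
    (fun p : ℝ × ℝ × ℝ => p.1 * p.2.1 + p.2.2)) hA hB rfl hAB.symm ?_
    (hn₀ #A (by omega)) ?_
  · rw [one_mul]
    refine le_trans (le_of_eq ?_) key
    rw [← Real.rpow_natCast, ← Real.rpow_mul hN0]
    norm_num
  · intro a ha c hc b hb
    exact mem_image.2 ⟨(a, b, c), by simp [ha, hb, hc], by simp [add_comm]⟩
  · rw [← Real.rpow_natCast, ← Real.rpow_mul hN0]
    norm_num
end

section
/- For every ε > 0 there exists a constant C > 0 such that for every natural number n there exists a finite set A of rational numbers with |A| ≥ n, |A| ≥ 16, and |AA+A| ≤ C·|A|² / (log log |A|)^(2·ln 2 − 1 − ε). -/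
theorem eq_and_eq_of_odd_mul_two_pow_eq {a b i k : ℕ}
    (h : (2 * a + 1) * 2 ^ k = (2 * b + 1) * 2 ^ i) : i = k ∧ a = b := by
  have key : ∀ {a b i k : ℕ}, (2 * a + 1) * 2 ^ k = (2 * b + 1) * 2 ^ i → k ≤ i := by
    intro a b i k h
    by_contra! hlt
    obtain ⟨d, rfl⟩ := Nat.exists_eq_add_of_lt hlt
    have h2 : (2 * a + 1) * 2 ^ (d + 1) = 2 * b + 1 := by
      apply Nat.eq_of_mul_eq_mul_right (pow_pos two_pos i)
      rw [← h]
      ring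
    rw [pow_succ, ← mul_assoc] at h2
    omega
  have hik : i = k := le_antisymm (key h.symm) (key h)
  subst hik
  have := Nat.eq_of_mul_eq_mul_right (pow_pos two_pos i) h
  exact ⟨rfl, by omega⟩

/-- The dyadic rationals `u / 2 ^ (J + i)` with `i < J` and `u` odd, `u < 2 * 8 ^ J`. -/
def dyadicSet (J : ℕ) : Finset ℚ :=
  (Finset.range J ×ˢ Finset.range (8 ^ J)).image
    (fun p : ℕ × ℕ => ((2 * p.2 + 1 : ℕ) : ℚ) / 2 ^ (J + p.1))

theorem card_dyadicSet (J : ℕ) : (dyadicSet J).card = J * 8 ^ J := by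
  rw [dyadicSet, Finset.card_image_of_injective, Finset.card_product, Finset.card_range,
    Finset.card_range]
  rintro ⟨i, a⟩ ⟨k, b⟩ h
  simp only at h
  rw [div_eq_div_iff (by positivity) (by positivity), pow_add, pow_add] at h
  have h2 : ((2 * a + 1 : ℕ) : ℚ) * 2 ^ k = ((2 * b + 1 : ℕ) : ℚ) * 2 ^ i := by
    apply mul_right_cancel₀ (pow_ne_zero J (two_ne_zero (α := ℚ)))
    linear_combination h
  have h3 : (2 * a + 1) * 2 ^ k = (2 * b + 1) * 2 ^ i := by exact_mod_cast h2
  obtain ⟨rfl, rfl⟩ := eq_and_eq_of_odd_mul_two_pow_eq h3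
  rfl

theorem card_image_mul_add_dyadicSet_le (J : ℕ) :
    ((dyadicSet J ×ˢ dyadicSet J ×ˢ dyadicSet J).image
      (fun p : ℚ × ℚ × ℚ => p.1 * p.2.1 + p.2.2)).card ≤ 2 * J * (6 * (8 ^ J) ^ 2) := by
  have hsub : (dyadicSet J ×ˢ dyadicSet J ×ˢ dyadicSet J).image
      (fun p : ℚ × ℚ × ℚ => p.1 * p.2.1 + p.2.2) ⊆
      (Finset.range (2 * J) ×ˢ Finset.range (6 * (8 ^ J) ^ 2)).image
        (fun p : ℕ × ℕ => (p.2 : ℚ) / 2 ^ (2 * J + p.1)) := by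
    intro x hx
    simp only [dyadicSet, Finset.mem_image, Finset.mem_product, Finset.mem_range,
      Prod.exists] at hx ⊢
    obtain ⟨_, _, _, ⟨⟨i, a, ⟨hi, ha⟩, rfl⟩, ⟨k, b, ⟨hk, hb⟩, rfl⟩, ⟨l, c, ⟨hl, hc⟩, rfl⟩⟩,
      rfl⟩ := hx
    obtain ⟨e, he⟩ := Nat.exists_eq_add_of_le (show l ≤ J + i + k by omega)
    refine ⟨i + k, (2 * a + 1) * (2 * b + 1) + (2 * c + 1) * 2 ^ e, ⟨by omega, ?_⟩, ?_⟩
    · have hpow : 2 ^ e ≤ 8 ^ J := by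
        rw [show 8 = 2 ^ 3 by norm_num, ← pow_mul]
        exact Nat.pow_le_pow_right two_pos (by omega)
      have h1 : (2 * a + 1) * (2 * b + 1) < (2 * 8 ^ J) * (2 * 8 ^ J) :=
        Nat.mul_lt_mul'' (by omega) (by omega)
      have h2 : (2 * c + 1) * 2 ^ e ≤ (2 * 8 ^ J) * 8 ^ J :=
        Nat.mul_le_mul (by omega) hpow
      nlinarith
    · rw [show 2 * J + (i + k) = (J + l) + e by omega, div_mul_div_comm, ← pow_add,
        show J + i + (J + k) = (J + l) + e by omega, pow_add _ (J + l) e]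
      push_cast
      field_simp
  calc _ ≤ _ := Finset.card_le_card hsub
    _ ≤ _ := Finset.card_image_le
    _ = _ := by simp

theorem log_log_rpow_le_log {x t : ℝ} (hx : 16 ≤ x) (ht : t ≤ 1) :
    0 < Real.log (Real.log x) ^ t ∧ Real.log (Real.log x) ^ t ≤ Real.log x := by
  have hlog : Real.exp 1 ≤ Real.log x := by
    have h16 : Real.log 16 = 4 * Real.log 2 := by
      rw [show (16 : ℝ) = 2 ^ 4 by norm_num, Real.log_pow]
      norm_num
    have := Real.log_le_log (by norm_num) hx
    linarith [Real.log_two_gt_d9, Real.exp_one_lt_d9]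
  have hpos : 0 < Real.log x := (Real.exp_pos 1).trans_le hlog
  have hone : 1 ≤ Real.log (Real.log x) := (Real.le_log_iff_exp_le hpos).2 hlog
  refine ⟨Real.rpow_pos_of_pos (by linarith) t, ?_⟩
  calc Real.log (Real.log x) ^ t ≤ Real.log (Real.log x) ^ (1 : ℝ) :=
        Real.rpow_le_rpow_of_exponent_le hone ht
    _ ≤ Real.log x := by
        rw [Real.rpow_one]
        exact Real.log_le_self hpos.le

theorem log_mul_eight_pow_le (J : ℕ) : Real.log ((J * 8 ^ J : ℕ) : ℝ) ≤ 4 * J := by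
  rcases Nat.eq_zero_or_pos J with rfl | hJ
  · simp
  have hle : ((J * 8 ^ J : ℕ) : ℝ) ≤ 2 ^ (4 * J) := by
    have : J * 8 ^ J ≤ 2 ^ (4 * J) := by
      calc J * 8 ^ J ≤ 2 ^ J * 8 ^ J := Nat.mul_le_mul_right _ J.lt_two_pow_self.le
        _ = 2 ^ (4 * J) := by rw [← mul_pow, pow_mul]; norm_num
    exact_mod_cast this
  have h := Real.log_le_log (by positivity) hle
  rw [Real.log_pow] at h
  push_cast at h ⊢
  nlinarith [Real.log_two_lt_d9, (Nat.cast_nonneg J : (0 : ℝ) ≤ J)]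

/-- For every `ε > 0` there is `C > 0` such that for every `n` there is a finite set `A`
of rationals with `|A| ≥ n`, `|A| ≥ 16` and
`|AA+A| ≤ C·|A|² / (log log |A|)^(2·ln 2 − 1 − ε)`. -/
theorem exists_small_AA_add_A :
    ∀ ε : ℝ, 0 < ε → ∃ C : ℝ, 0 < C ∧ ∀ n : ℕ, ∃ A : Finset ℚ,
      n ≤ A.card ∧ 16 ≤ A.card ∧
      (((A ×ˢ A ×ˢ A).image
          (fun p : ℚ × ℚ × ℚ => p.1 * p.2.1 + p.2.2)).card : ℝ) ≤
        C * (A.card : ℝ) ^ 2 /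
          (Real.log (Real.log (A.card : ℝ))) ^ (2 * Real.log 2 - 1 - ε) := by
  intro ε hε
  refine ⟨48, by norm_num, fun n => ?_⟩
  set J := n + 2 with hJ
  have hcard := card_dyadicSet J
  have h64 : 8 ^ 2 ≤ 8 ^ J := Nat.pow_le_pow_right (by norm_num) (by omega)
  have h16 : 16 ≤ (dyadicSet J).card := by
    rw [hcard]
    nlinarith
  refine ⟨dyadicSet J, ?_, h16, ?_⟩
  · rw [hcard]
    nlinarith
  obtain ⟨hpos, hle⟩ := log_log_rpow_le_log (x := ((dyadicSet J).card : ℝ))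
    (t := 2 * Real.log 2 - 1 - ε) (by exact_mod_cast h16) (by linarith [Real.log_two_lt_d9])
  have hlog : Real.log ((dyadicSet J).card : ℝ) ≤ 4 * J := by
    rw [hcard]
    exact log_mul_eight_pow_le J
  rw [le_div_iff₀ hpos]
  have himage : (((dyadicSet J ×ˢ dyadicSet J ×ˢ dyadicSet J).image
      (fun p : ℚ × ℚ × ℚ => p.1 * p.2.1 + p.2.2)).card : ℝ) ≤ 2 * J * (6 * (8 ^ J) ^ 2) := by
    exact_mod_cast card_image_mul_add_dyadicSet_le J
  calc _ ≤ (2 * J * (6 * (8 ^ J) ^ 2) : ℝ) * (4 * J) :=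
        mul_le_mul himage (hle.trans hlog) hpos.le (by positivity)
    _ = 48 * ((dyadicSet J).card : ℝ) ^ 2 := by
        rw [hcard]
        push_cast
        ring
end
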